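/- Let p = (1,0,0,0,0,0,0) ∈ S⁶, which lies in S⁶ \ T. The third homotopy group π₃(S⁶ \ T, p) is isomorphic, as a group, to ℤ × ℤ (the free abelian group of rank 2). -/

import Mathlib

/- STATEMENT 9: Let p = (1,0,0,0,0,0,0) ∈ S⁶, which lies in S⁶ \ T. Then
   π₃(S⁶ \ T, p) is isomorphic, as a group, to ℤ × ℤ (free abelian of rank 2). -/

noncomputable section

abbrev E (n : ℕ) : Type := EuclideanSpace ℝ (Fin n)

/-- The standard torus `T ⊂ S⁶`. -/
def T : Set (E 7) :=
  {x | x ∈ Metric.sphere (0 : E 7) 1 ∧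
       x 0 ^ 2 + x 1 ^ 2 + x 2 ^ 2 = 1 / 2 ∧ x 3 ^ 2 + x 4 ^ 2 = 1 / 2}

/-- The base point `p = (1,0,0,0,0,0,0)`, as an element of `S⁶ \ T`. -/
def basePoint : (Metric.sphere (0 : E 7) 1 \ T : Set (E 7)) :=
  ⟨EuclideanSpace.single (0 : Fin 7) 1, by
    constructor
    · simp [mem_sphere_zero_iff_norm]
    · intro h
      have h2 := h.2.1
      simp [EuclideanSpace.single_apply] at h2⟩

namespace TorusComplement

open Set Topology unitInterval

/-- The `n`-dimensional unit cube. -/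
abbrev UnitCube (n : ℕ) := Fin n → I

/-- Projection of the real line to the unit interval. -/
abbrev clamp (t : ℝ) : I := projIcc 0 1 zero_le_one t

theorem continuous_clamp : Continuous clamp := continuous_projIcc

@[fun_prop]
theorem _root_.Continuous.clamp {Y : Type*} [TopologicalSpace Y] {f : Y → ℝ}
    (hf : Continuous f) : Continuous fun y => clamp (f y) := continuous_clamp.comp hf

theorem clamp_of_le {t : ℝ} (h : t ≤ 0) : clamp t = 0 := projIcc_of_le_left _ h

theorem clamp_of_ge {t : ℝ} (h : 1 ≤ t) : clamp t = 1 := projIcc_of_right_le _ h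

@[simp] theorem clamp_coe (t : I) : clamp (t : ℝ) = t := projIcc_val _ t

theorem coe_clamp_of_mem {t : ℝ} (h : t ∈ Icc (0 : ℝ) 1) : ((clamp t : I) : ℝ) = t := by
  rw [clamp, projIcc_of_mem _ h]

@[simp] theorem clamp_zero : clamp 0 = 0 := clamp_of_le le_rfl

@[simp] theorem clamp_one : clamp 1 = 1 := clamp_of_ge le_rfl

section Loops

variable {V V' : Type*} [TopologicalSpace V] [TopologicalSpace V'] {n : ℕ}
  {S' : Set V'} {x' : S'} {S : Set V} {x : S}

/-- `f` is a generalized loop in the set `S` based at `x`. -/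
structure IsLoop (S : Set V) (x : S) (f : UnitCube n → V) : Prop where
  cont : Continuous f
  mem : ∀ z, f z ∈ S
  bdry : ∀ z ∈ Cube.boundary (Fin n), f z = x

/-- Homotopy relative to the boundary of the cube, inside the set `S`. -/
def LoopHomotopic (S : Set V) (x : S) (f g : UnitCube n → V) : Prop :=
  ∃ H : I → UnitCube n → V, Continuous (Function.uncurry H) ∧ (∀ r z, H r z ∈ S) ∧
    H 0 = f ∧ H 1 = g ∧ ∀ r, ∀ z ∈ Cube.boundary (Fin n), H r z = x

/-- The generalized loop given by a function. -/
def IsLoop.genLoop {f : UnitCube n → V} (h : IsLoop S x f) : GenLoop (Fin n) S x :=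
  ⟨⟨fun z => ⟨f z, h.mem z⟩, h.cont.subtype_mk _⟩, fun z hz => Subtype.ext (h.bdry z hz)⟩

/-- The class of a loop in the homotopy group. -/
def IsLoop.cls {f : UnitCube n → V} (h : IsLoop S x f) : HomotopyGroup (Fin n) S x :=
  Quotient.mk (GenLoop.Homotopic.setoid (Fin n) x) h.genLoop

theorem exists_loop (a : HomotopyGroup (Fin n) S x) :
    ∃ f, ∃ h : IsLoop S x f, h.cls = a := by
  induction a using Quotient.inductionOn with
  | h γ =>
    exact ⟨fun z => γ z, ⟨by have := γ.1.continuous; exact continuous_subtype_val.comp this,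
      fun z => (γ z).2, fun z hz => congrArg _ (γ.2 z hz)⟩, rfl⟩

theorem cls_eq_iff {f g : UnitCube n → V} (hf : IsLoop S x f) (hg : IsLoop S x g) :
    hf.cls = hg.cls ↔ LoopHomotopic S x f g := by
  refine Quotient.eq.trans ⟨?_, ?_⟩
  · rintro ⟨H⟩
    refine ⟨fun r z => H (r, z), continuous_subtype_val.comp H.continuous, fun r z => (H (r, z)).2,
      ?_, ?_, ?_⟩
    · ext z; exact congrArg Subtype.val (H.apply_zero z)
    · ext z; exact congrArg Subtype.val (H.apply_one z)
    · intro r z hz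
      exact (congrArg Subtype.val (H.eq_fst r hz)).trans (hf.bdry z hz)
  · rintro ⟨H, hc, hS, h0, h1, hb⟩
    refine ⟨⟨⟨⟨fun p => ⟨H p.1 p.2, hS _ _⟩, hc.subtype_mk _⟩, ?_, ?_⟩, ?_⟩⟩
    · intro z; ext; simp [h0, IsLoop.genLoop]
    · intro z; ext; simp [h1, IsLoop.genLoop]
    · intro r z hz
      ext
      simpa [IsLoop.genLoop, hf.bdry z hz] using hb r z hz

theorem cls_congr {f g : UnitCube n → V} (hf : IsLoop S x f) (hg : IsLoop S x g) (h : f = g) :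
    hf.cls = hg.cls := by subst h; rfl

/-- Concatenation in the `i`-th coordinate. -/
def concat (i : Fin n) (f g : UnitCube n → V) (z : UnitCube n) : V :=
  if (z i : ℝ) ≤ 1 / 2 then f (Function.update z i (clamp (2 * z i)))
  else g (Function.update z i (clamp (2 * z i - 1)))

theorem IsLoop.concat_eq (i : Fin n) {f g : UnitCube n → V} (hf : IsLoop S x f)
    (hg : IsLoop S x g) :
    concat i f g = fun z => (GenLoop.transAt i hf.genLoop hg.genLoop z : V) := by
  ext z
  simp only [concat, GenLoop.transAt, GenLoop.coe_copy]
  split_ifs <;> rfl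

theorem IsLoop.concat (i : Fin n) {f g : UnitCube n → V} (hf : IsLoop S x f)
    (hg : IsLoop S x g) : IsLoop S x (concat i f g) := by
  rw [hf.concat_eq i hg]
  set γ := GenLoop.transAt i hf.genLoop hg.genLoop
  exact ⟨continuous_subtype_val.comp γ.1.continuous, fun z => (γ z).2,
    fun z hz => congrArg _ (γ.2 z hz)⟩

theorem cls_mul (i : Fin (n + 1)) {f g : UnitCube (n + 1) → V} (hf : IsLoop S x f)
    (hg : IsLoop S x g) : hf.cls * hg.cls = (hg.concat i hf).cls := by
  refine (HomotopyGroup.mul_spec (i := i)).trans (congrArg _ ?_)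
  ext z
  exact (congrFun (hg.concat_eq i hf) z).symm

theorem isLoop_const : IsLoop S x (fun _ : UnitCube n => (x : V)) :=
  ⟨continuous_const, fun _ => x.2, fun _ _ => rfl⟩

theorem cls_const : (isLoop_const : IsLoop S x (fun _ : UnitCube (n + 1) => (x : V))).cls = 1 := rfl

/-- A continuous based map between subsets. -/
structure BasedMap (S : Set V) (x : S) (S' : Set V') (x' : S') (φ : V → V') : Prop where
  cont : ContinuousOn φ S
  maps : MapsTo φ S S'
  base : φ x = x'

theorem IsLoop.map {φ : V → V'} (hφ : BasedMap S x S' x' φ) {f : UnitCube n → V}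
    (hf : IsLoop S x f) : IsLoop S' x' (fun z => φ (f z)) :=
  ⟨hφ.cont.comp_continuous hf.cont hf.mem, fun z => hφ.maps (hf.mem z),
    fun z hz => by rw [hf.bdry z hz, hφ.base]⟩

/-- A homomorphism of homotopy groups given by an operation on loops. -/
theorem exists_hom {k : ℕ} (Φ : (UnitCube (n + 1) → V) → (UnitCube (k + 1) → V'))
    (hΦ : ∀ f, IsLoop S x f → IsLoop S' x' (Φ f))
    (hH : ∀ f g, IsLoop S x f → IsLoop S x g → LoopHomotopic S x f g →
      LoopHomotopic S' x' (Φ f) (Φ g))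
    (i : Fin (n + 1)) (j : Fin (k + 1))
    (hm : ∀ f g, IsLoop S x f → IsLoop S x g → Φ (concat i f g) = concat j (Φ f) (Φ g)) :
    ∃ φ : HomotopyGroup (Fin (n + 1)) S x →* HomotopyGroup (Fin (k + 1)) S' x',
      ∀ f (hf : IsLoop S x f), φ hf.cls = (hΦ f hf).cls := by
  choose rep hrep hcls using fun a : HomotopyGroup (Fin (n + 1)) S x => exists_loop a
  let φ : HomotopyGroup (Fin (n + 1)) S x → HomotopyGroup (Fin (k + 1)) S' x' :=
    fun a => (hΦ _ (hrep a)).cls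
  have key : ∀ f (hf : IsLoop S x f), φ hf.cls = (hΦ f hf).cls := fun f hf =>
    (cls_eq_iff _ _).2 (hH _ _ (hrep _) hf ((cls_eq_iff _ _).1 (hcls hf.cls)))
  refine ⟨MonoidHom.mk' φ fun a b => ?_, key⟩
  obtain ⟨f, hf, rfl⟩ := exists_loop a
  obtain ⟨g, hg, rfl⟩ := exists_loop b
  rw [cls_mul i hf hg, key, key, key, cls_mul j]
  exact cls_congr _ _ (hm g f hg hf)

theorem exists_map {φ : V → V'} (hφ : BasedMap S x S' x' φ) (n : ℕ) :
    ∃ F : HomotopyGroup (Fin (n + 1)) S x →* HomotopyGroup (Fin (n + 1)) S' x',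
      ∀ f (hf : IsLoop S x f), F hf.cls = (hf.map hφ).cls := by
  refine exists_hom (fun f z => φ (f z)) (fun f hf => hf.map hφ) ?_ 0 0 ?_
  · rintro f g - - ⟨H, hc, hS, rfl, rfl, hb⟩
    exact ⟨fun r z => φ (H r z), hφ.cont.comp_continuous hc fun p => hS _ _,
      fun r z => hφ.maps (hS r z), rfl, rfl, fun r z hz => by simp only [hb r z hz, hφ.base]⟩
  · intro f g _ _
    ext z
    simp only [concat]
    split_ifs <;> rfl

/-- The homomorphism induced by a based map. -/
def mapHom {φ : V → V'} (hφ : BasedMap S x S' x' φ) (n : ℕ) :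
    HomotopyGroup (Fin (n + 1)) S x →* HomotopyGroup (Fin (n + 1)) S' x' :=
  (exists_map hφ n).choose

theorem mapHom_cls {φ : V → V'} (hφ : BasedMap S x S' x' φ) {f : UnitCube (n + 1) → V}
    (hf : IsLoop S x f) : mapHom hφ n hf.cls = (hf.map hφ).cls :=
  (exists_map hφ n).choose_spec f hf

theorem LoopHomotopic.trans {f g h : UnitCube n → V} (hf : IsLoop S x f) (hg : IsLoop S x g)
    (hh : IsLoop S x h) (h₁ : LoopHomotopic S x f g) (h₂ : LoopHomotopic S x g h) :
    LoopHomotopic S x f h :=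
  (cls_eq_iff hf hh).1 (((cls_eq_iff hf hg).2 h₁).trans ((cls_eq_iff hg hh).2 h₂))

/-- A based deformation moves a loop within its homotopy class. -/
theorem cls_eq_of_deform {φ ψ : UnitCube n → V} (hφ : IsLoop S x φ) (hψ : IsLoop S x ψ)
    (D : I → V → V) (P : Set V) (hP : ∀ z, φ z ∈ P)
    (hc : ContinuousOn (Function.uncurry D) (univ ×ˢ P))
    (hS : ∀ r, ∀ y ∈ P, D r y ∈ S) (hx : ∀ r, D r x = x) (h0 : ∀ z, D 0 (φ z) = φ z)
    (h1 : ∀ z, D 1 (φ z) = ψ z) : hφ.cls = hψ.cls := by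
  refine (cls_eq_iff _ _).2 ⟨fun r z => D r (φ z), ?_, fun r z => hS _ _ (hP z), funext h0,
    funext h1, fun r z hz => by simp only [hφ.bdry z hz, hx]⟩
  exact hc.comp_continuous (f := fun p : I × UnitCube n => (p.1, φ p.2))
    (continuous_fst.prodMk (hφ.cont.comp continuous_snd)) fun p => ⟨mem_univ _, hP _⟩

end Loops

section Linear

variable {V : Type*} [AddCommGroup V] [Module ℝ V] [TopologicalSpace V] [ContinuousAdd V]
  [ContinuousSMul ℝ V] {n : ℕ} {S : Set V} {x : S}

theorem cls_eq_of_segment {f g : UnitCube n → V} (hf : IsLoop S x f) (hg : IsLoop S x g)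
    (h : ∀ z, ∀ r ∈ Icc (0 : ℝ) 1, (1 - r) • f z + r • g z ∈ S) : hf.cls = hg.cls := by
  have := hf.cont
  have := hg.cont
  refine (cls_eq_iff _ _).2 ⟨fun r z => (1 - (r : ℝ)) • f z + (r : ℝ) • g z, ?_,
    fun r z => h z r r.2, ?_, ?_, fun r z hz => ?_⟩
  · unfold Function.uncurry; fun_prop
  · ext z; simp
  · ext z; simp
  · simp only [hf.bdry z hz, hg.bdry z hz, ← add_smul]; simp

end Linear

section Cons

variable {n : ℕ}

theorem cons_mem_boundary {t : I} {s : UnitCube n} :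
    (Fin.cons t s : UnitCube (n + 1)) ∈ Cube.boundary (Fin (n + 1)) ↔
      t = 0 ∨ t = 1 ∨ s ∈ Cube.boundary (Fin n) := by
  simp [Cube.boundary, Fin.exists_fin_succ, or_assoc]

theorem mem_boundary_succ {z : UnitCube (n + 1)} :
    z ∈ Cube.boundary (Fin (n + 1)) ↔
      z 0 = 0 ∨ z 0 = 1 ∨ Fin.tail z ∈ Cube.boundary (Fin n) := by
  conv_lhs => rw [← Fin.cons_self_tail z]
  exact cons_mem_boundary

@[fun_prop]
theorem continuous_cons_cube :
    Continuous fun p : I × UnitCube n => (Fin.cons p.1 p.2 : UnitCube (n + 1)) :=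
  Continuous.finCons continuous_fst continuous_snd

@[fun_prop]
theorem continuous_tail_cube : Continuous fun z : UnitCube (n + 1) => (Fin.tail z : UnitCube n) :=
  continuous_pi fun i => continuous_apply i.succ

end Cons

section Lifting

/-- Homotopy lifting from a local transport function. -/
theorem exists_lift {X B Y : Type*} [TopologicalSpace X] [PseudoMetricSpace B]
    [PseudoMetricSpace Y] [CompactSpace Y] (p : X → B) (S : Set B) {ρ : ℝ} (hρ : 0 < ρ)
    (τ : X → B → X)
    (hτc : ContinuousOn (Function.uncurry τ) {e | p e.1 ∈ S ∧ e.2 ∈ S ∧ dist (p e.1) e.2 < ρ})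
    (hτp : ∀ e b, p e ∈ S → b ∈ S → dist (p e) b < ρ → p (τ e b) = b)
    (hτe : ∀ e, p e ∈ S → τ e (p e) = e)
    (H : Y → I → B) (hH : Continuous (Function.uncurry H)) (hS : ∀ y t, H y t ∈ S)
    (L₀ : Y → X) (hL₀ : Continuous L₀) (hp₀ : ∀ y, p (L₀ y) = H y 0) :
    ∃ L : Y → I → X, Continuous (Function.uncurry L) ∧ (∀ y t, p (L y t) = H y t) ∧
      (∀ y, L y 0 = L₀ y) ∧ ∀ y, (∀ t, H y t = H y 0) → ∀ t, L y t = L₀ y := by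
  obtain ⟨δ, hδ, hδ'⟩ := Metric.uniformContinuous_iff.1
    (CompactSpace.uniformContinuous_of_continuous hH) ρ hρ
  obtain ⟨N, hN⟩ := exists_nat_one_div_lt hδ
  have hN0 : (0 : ℝ) < (N : ℝ) + 1 := by positivity
  have hstep : ∀ k : ℕ, k < N + 1 → ∀ (y : Y) (t : I),
      dist (H y (min t (clamp (k / ((N : ℝ) + 1)))))
        (H y (min t (clamp ((k + 1 : ℕ) / ((N : ℝ) + 1)))))
        < ρ := by
    intro k hk y t
    refine hδ' (a := (y, _)) (b := (y, _)) ?_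
    rw [Prod.dist_eq, dist_self, max_eq_right dist_nonneg, Subtype.dist_eq, Real.dist_eq]
    have hk' : ((k : ℝ) + 1) ≤ N + 1 := by exact_mod_cast hk
    have h1 : ((clamp (k / ((N : ℝ) + 1)) : I) : ℝ) = k / ((N : ℝ) + 1) :=
      coe_clamp_of_mem ⟨by positivity, (div_le_one hN0).2 (by linarith)⟩
    have h2 : ((clamp ((k + 1 : ℕ) / ((N : ℝ) + 1)) : I) : ℝ) = (k + 1 : ℕ) / ((N : ℝ) + 1) :=
      coe_clamp_of_mem ⟨by positivity, (div_le_one hN0).2 (by push_cast; linarith)⟩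
    have hmin : ∀ a b : I, ((min a b : I) : ℝ) = min (a : ℝ) b := fun a b =>
      (Subtype.mono_coe _).map_min
    rw [hmin, hmin, h1, h2]
    refine lt_of_le_of_lt ?_ hN
    have h3 : ((k + 1 : ℕ) : ℝ) / ((N : ℝ) + 1) = k / ((N : ℝ) + 1) + 1 / ((N : ℝ) + 1) := by
      push_cast; ring
    have h4 : 0 < 1 / ((N : ℝ) + 1) := by positivity
    rw [h3, abs_le]
    constructor <;> grind
  have key : ∀ k : ℕ, k ≤ N + 1 → ∃ L : Y → I → X, Continuous (Function.uncurry L) ∧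
      (∀ y t, p (L y t) = H y (min t (clamp (k / ((N : ℝ) + 1))))) ∧
      (∀ y, L y 0 = L₀ y) ∧ ∀ y, (∀ t, H y t = H y 0) → ∀ t, L y t = L₀ y := by
    intro k
    induction k with
    | zero =>
      intro _
      refine ⟨fun y _ => L₀ y, hL₀.comp continuous_fst, fun y t => ?_, fun _ => rfl,
        fun _ _ _ => rfl⟩
      simp [hp₀]
    | succ k ih =>
      intro hk
      obtain ⟨L, hLc, hLp, hL0, hLconst⟩ := ih (by omega)
      have hst := hstep k (by omega)
      set c := clamp ((k + 1 : ℕ) / ((N : ℝ) + 1)) with hc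
      refine ⟨fun y t => τ (L y t) (H y (min t c)), ?_, ?_, ?_, ?_⟩
      · refine hτc.comp_continuous (f := fun q : Y × I => (L q.1 q.2, H q.1 (min q.2 c)))
          (hLc.prodMk (hH.comp (continuous_fst.prodMk (continuous_snd.min continuous_const)))) ?_
        intro q
        refine ⟨?_, hS _ _, ?_⟩
        · simp only [hLp]; exact hS _ _
        · simp only [hLp]; exact hst _ _
      · intro y t
        refine hτp _ _ ?_ (hS _ _) ?_
        · simp only [hLp]; exact hS _ _
        · simp only [hLp]; exact hst _ _
      · intro y
        have h0 : ∀ a : I, min 0 a = 0 := fun a => min_eq_left a.2.1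
        have : H y (min 0 c) = p (L y 0) := by rw [hLp, h0, h0]
        simp only [this]
        rw [hτe _ (by rw [← this]; exact hS _ _), hL0]
      · intro y hy t
        have : H y (min t c) = p (L y t) := by rw [hLp, hy, hy (min t (clamp _))]
        simp only [this]
        rw [hτe _ (by rw [← this]; exact hS _ _), hLconst y hy]
  obtain ⟨L, hLc, hLp, hL⟩ := key (N + 1) le_rfl
  refine ⟨L, hLc, fun y t => ?_, hL⟩
  rw [hLp]
  have : (((N + 1 : ℕ) : ℝ) / ((N : ℝ) + 1)) = 1 := by push_cast; exact div_self hN0.ne'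
  rw [this, clamp_one, min_eq_left (show t ≤ 1 from t.2.2)]

theorem exists_norm_lower_bound {Y V : Type*} [TopologicalSpace Y] [CompactSpace Y]
    [NormedAddCommGroup V] (f : Y → V) (hf : Continuous f) (h0 : ∀ y, f y ≠ 0) :
    ∃ δ > 0, ∀ y, δ ≤ ‖f y‖ := by
  rcases isEmpty_or_nonempty Y with h | h
  · exact ⟨1, one_pos, fun y => h.elim y⟩
  · obtain ⟨y, -, hy⟩ := isCompact_univ.exists_isMinOn univ_nonempty hf.norm.continuousOn
    exact ⟨‖f y‖, norm_pos_iff.2 (h0 y), fun y' => hy (mem_univ y')⟩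

theorem exists_lift_exp {Y : Type*} [PseudoMetricSpace Y] [CompactSpace Y]
    (H : Y → I → ℂ) (hH : Continuous (Function.uncurry H)) (h0 : ∀ y t, H y t ≠ 0)
    (L₀ : Y → ℂ) (hL₀ : Continuous L₀) (hp₀ : ∀ y, Complex.exp (L₀ y) = H y 0) :
    ∃ L : Y → I → ℂ, Continuous (Function.uncurry L) ∧ (∀ y t, Complex.exp (L y t) = H y t) ∧
      (∀ y, L y 0 = L₀ y) ∧ ∀ y, (∀ t, H y t = H y 0) → ∀ t, L y t = L₀ y := by
  obtain ⟨δ, hδ, hδH⟩ := exists_norm_lower_bound _ hH fun q => h0 q.1 q.2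
  have hslit : ∀ e b, Complex.exp e ∈ {b : ℂ | δ ≤ ‖b‖} → dist (Complex.exp e) b < δ →
      b * Complex.exp (-e) ∈ Complex.slitPlane := by
    intro e b he hd
    refine Complex.mem_slitPlane_of_norm_lt_one (z := b * Complex.exp (-e) - 1) ?_ |> fun h => by
      simpa using h
    have : b * Complex.exp (-e) - 1 = (b - Complex.exp e) * Complex.exp (-e) := by
      rw [sub_mul, ← Complex.exp_add]; simp
    rw [this, norm_mul, Complex.exp_neg, norm_inv, ← div_eq_mul_inv,
      div_lt_one (by simp)]
    rw [dist_comm, dist_eq_norm] at hd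
    exact hd.trans_le he
  refine exists_lift Complex.exp {b | δ ≤ ‖b‖} hδ
    (fun e b => e + Complex.log (b * Complex.exp (-e))) ?_ ?_ ?_ H hH
    (fun y t => hδH (y, t)) L₀ hL₀ hp₀
  · refine continuous_fst.continuousOn.add (ContinuousOn.clog ?_ fun q hq => hslit _ _ hq.1 hq.2.2)
    fun_prop
  · intro e b he hb hd
    rw [Complex.exp_add, Complex.exp_log (Complex.slitPlane_ne_zero (hslit e b he hd)),
      mul_left_comm, ← Complex.exp_add]
    simp
  · intro e _
    simp [← Complex.exp_add]

theorem eq_zero_of_exp_eq_one {Y : Type*} [TopologicalSpace Y] [PreconnectedSpace Y]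
    {L : Y → ℂ} (hL : Continuous L) (h1 : ∀ y, Complex.exp (L y) = 1) {y₀ : Y} (h0 : L y₀ = 0)
    (y : Y) : L y = 0 := by
  have hclopen : IsClopen {y | L y = 0} := by
    refine ⟨isClosed_eq hL continuous_const, ?_⟩
    have : {y | L y = 0} = {y | ‖L y‖ < 1} := by
      ext y
      refine ⟨fun h => ?_, fun h => ?_⟩
      · have : L y = 0 := h
        simp [this]
      obtain ⟨n, hn⟩ := Complex.exp_eq_one_iff.1 (h1 y)
      rw [mem_ofPred_eq, hn] at h ⊢
      have hpi := Real.pi_gt_three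
      rw [norm_mul, norm_mul, norm_mul, Complex.norm_I, Complex.norm_real, Complex.norm_intCast,
        Real.norm_of_nonneg Real.pi_pos.le] at h
      have : |(n : ℝ)| < 1 := by
        norm_num at h
        nlinarith [abs_nonneg (n : ℝ)]
      have : n = 0 := by
        rw [← Int.cast_abs] at this
        have h2 : |n| < 1 := by exact_mod_cast this
        exact Int.abs_lt_one_iff.1 h2
      simp [this]
    rw [this]
    exact isOpen_lt hL.norm continuous_const
  have := hclopen.eq_univ ⟨y₀, h0⟩
  exact (this ▸ mem_univ y : y ∈ {y | L y = 0})

theorem exists_log_cube {n : ℕ} (c : UnitCube (n + 2) → ℂ) (hc : Continuous c)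
    (h0 : ∀ z, c z ≠ 0) (hb : ∀ z ∈ Cube.boundary (Fin (n + 2)), c z = 1) :
    ∃ L : UnitCube (n + 2) → ℂ, Continuous L ∧ (∀ z, Complex.exp (L z) = c z) ∧
      ∀ z ∈ Cube.boundary (Fin (n + 2)), L z = 0 := by
  obtain ⟨L, hLc, hLp, hL0, hLb⟩ := exists_lift_exp
    (fun (s : UnitCube (n + 1)) (t : I) => c (Fin.cons t s))
    (by unfold Function.uncurry; exact hc.comp (continuous_cons_cube.comp continuous_swap))
    (fun s t => h0 _) (fun _ => 0) continuous_const
    (fun s => by rw [hb _ (cons_mem_boundary.2 (Or.inl rfl))]; simp)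
  have hLb' : ∀ s ∈ Cube.boundary (Fin (n + 1)), ∀ t, L s t = 0 := fun s hs t =>
    hLb s (fun t => by
      rw [hb _ (cons_mem_boundary.2 (Or.inr (Or.inr hs))),
        hb _ (cons_mem_boundary.2 (Or.inr (Or.inr hs)))]) t
  refine ⟨fun z => L (Fin.tail z) (z 0), ?_, fun z => ?_, fun z hz => ?_⟩
  · exact hLc.comp (continuous_tail_cube.prodMk (continuous_apply 0))
  · rw [hLp]; simp
  · rcases mem_boundary_succ.1 hz with h | h | h
    · simp only [h, hL0]
    · simp only [h]
      refine eq_zero_of_exp_eq_one (L := fun s => L s 1)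
        (hLc.comp (continuous_id.prodMk continuous_const)) (fun s => ?_) (y₀ := fun _ => 0)
        (hLb' _ ⟨0, Or.inl rfl⟩ _) _
      rw [hLp, hb _ (cons_mem_boundary.2 (Or.inr (Or.inl rfl)))]
    · exact hLb' _ h _

end Lifting

end TorusComplement

namespace TorusComplement

open Set Topology unitInterval ComplexConjugate

section Hopf

/-- The quadratic Hopf map. -/
def hopf (z : ℂ × ℂ) : ℂ × ℝ :=
  (2 * z.1 * conj z.2, Complex.normSq z.1 - Complex.normSq z.2)

@[fun_prop]
theorem continuous_hopf : Continuous hopf := by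
  unfold hopf
  fun_prop

/-- The Euclidean norm on `ℂ × ℝ`. -/
def euclNorm (b : ℂ × ℝ) : ℝ := √(b.2 ^ 2 + Complex.normSq b.1)

@[fun_prop]
theorem continuous_euclNorm : Continuous euclNorm := by
  unfold euclNorm
  fun_prop

theorem euclNorm_nonneg (b : ℂ × ℝ) : 0 ≤ euclNorm b := Real.sqrt_nonneg _

theorem euclNorm_sq (b : ℂ × ℝ) : euclNorm b ^ 2 = b.2 ^ 2 + Complex.normSq b.1 :=
  Real.sq_sqrt (add_nonneg (sq_nonneg _) (Complex.normSq_nonneg _))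

theorem norm_le_euclNorm (b : ℂ × ℝ) : ‖b‖ ≤ euclNorm b := by
  refine max_le ?_ ?_
  · refine Real.le_sqrt_of_sq_le ?_
    rw [← Complex.normSq_eq_norm_sq]
    nlinarith [sq_nonneg b.2]
  · refine Real.le_sqrt_of_sq_le ?_
    rw [Real.norm_eq_abs, sq_abs]
    nlinarith [Complex.normSq_nonneg b.1]

theorem euclNorm_hopf (z : ℂ × ℂ) :
    euclNorm (hopf z) = Complex.normSq z.1 + Complex.normSq z.2 := by
  rw [euclNorm, Real.sqrt_eq_iff_mul_self_eq
    (add_nonneg (sq_nonneg _) (Complex.normSq_nonneg _))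
    (add_nonneg (Complex.normSq_nonneg _) (Complex.normSq_nonneg _))]
  simp only [hopf, map_mul, Complex.normSq_conj]
  norm_num [Complex.normSq_apply]
  ring

theorem hopf_ne_zero {z : ℂ × ℂ} (hz : z ≠ 0) : hopf z ≠ 0 := by
  intro h
  have h1 := euclNorm_hopf z
  rw [h] at h1
  simp [euclNorm] at h1
  have h2 := Complex.normSq_nonneg z.1
  have h3 := Complex.normSq_nonneg z.2
  exact hz (Prod.ext (Complex.normSq_eq_zero.1 (by linarith))
    (Complex.normSq_eq_zero.1 (by linarith)))

theorem hopf_zero : hopf 0 = 0 := by simp [hopf]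

/-- The unnormalized transport of `z` to the fibre of the Hopf map over a multiple of `b`. -/
def hopfMove (z : ℂ × ℂ) (b : ℂ × ℝ) : ℂ × ℂ :=
  ((euclNorm b + b.2 : ℝ) * z.1 + b.1 * z.2, conj b.1 * z.1 + (euclNorm b - b.2 : ℝ) * z.2)

theorem hopfMove_aux (b : ℂ × ℝ) :
    (euclNorm b : ℂ) ^ 2 = (b.2 : ℂ) ^ 2 + b.1 * conj b.1 := by
  rw [Complex.mul_conj]
  exact_mod_cast euclNorm_sq b

theorem mul_hopfMove_snd (z : ℂ × ℂ) (b : ℂ × ℝ) :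
    b.1 * (hopfMove z b).2 = (euclNorm b - b.2 : ℝ) * (hopfMove z b).1 := by
  simp only [hopfMove]
  push_cast
  linear_combination (-z.1) * hopfMove_aux b

theorem conj_mul_hopfMove_fst (z : ℂ × ℂ) (b : ℂ × ℝ) :
    conj b.1 * (hopfMove z b).1 = (euclNorm b + b.2 : ℝ) * (hopfMove z b).2 := by
  simp only [hopfMove]
  push_cast
  linear_combination (-z.2) * hopfMove_aux b

theorem euclNorm_smul_hopf_hopfMove (z : ℂ × ℂ) (b : ℂ × ℝ) :
    euclNorm b • hopf (hopfMove z b) = euclNorm (hopf (hopfMove z b)) • b := by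
  rw [euclNorm_hopf]
  have h1 := mul_hopfMove_snd z b
  have h2 := congrArg conj (conj_mul_hopfMove_fst z b)
  simp only [map_mul, Complex.conj_conj, Complex.conj_ofReal] at h2
  set m := hopfMove z b
  refine Prod.ext ?_ ?_
  · simp only [hopf, Prod.smul_fst, Complex.real_smul]
    push_cast at h1 h2 ⊢
    rw [← Complex.mul_conj, ← Complex.mul_conj]
    linear_combination (-conj m.2) * h1 - m.1 * h2
  · simp only [hopf, Prod.smul_snd, smul_eq_mul]
    have : ((euclNorm b - b.2 : ℝ) : ℂ) * Complex.normSq m.1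
        = ((euclNorm b + b.2 : ℝ) : ℂ) * Complex.normSq m.2 := by
      rw [← Complex.mul_conj, ← Complex.mul_conj]
      linear_combination (-conj m.1) * h1 + m.2 * h2
    have h3 : (euclNorm b - b.2) * Complex.normSq m.1 =
        (euclNorm b + b.2) * Complex.normSq m.2 := by
      exact_mod_cast this
    linear_combination h3

/-- Euclidean inner product on `ℂ × ℝ`. -/
def euclInner (b b' : ℂ × ℝ) : ℝ := (b.1 * conj b'.1).re + b.2 * b'.2

theorem euclNorm_hopf_hopfMove (z : ℂ × ℂ) (b : ℂ × ℝ) :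
    euclNorm (hopf (hopfMove z b)) =
      2 * euclNorm b * (euclNorm b * euclNorm (hopf z) + euclInner b (hopf z)) := by
  rw [euclNorm_hopf, euclNorm_hopf]
  have h := euclNorm_sq b
  simp only [hopfMove, hopf, euclInner]
  simp only [Complex.normSq_apply] at h ⊢
  simp
  linear_combination (-(z.1.re^2+z.1.im^2+z.2.re^2+z.2.im^2)) * h

theorem hopfMove_hopf (z : ℂ × ℂ) :
    hopfMove z (hopf z) = (2 * euclNorm (hopf z)) • z := by
  have h := euclNorm_hopf z
  refine Prod.ext ?_ ?_
  · simp only [hopfMove, h, Prod.smul_fst, Complex.real_smul]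
    simp only [hopf]
    push_cast
    rw [← Complex.mul_conj, ← Complex.mul_conj]
    ring
  · simp only [hopfMove, h, Prod.smul_snd, Complex.real_smul]
    simp only [hopf, map_mul, Complex.conj_conj, map_ofNat]
    push_cast
    rw [← Complex.mul_conj, ← Complex.mul_conj]
    ring

theorem euclInner_pos {b b' : ℂ × ℝ} {δ : ℝ} (hb : δ ≤ ‖b‖) (hb' : δ ≤ ‖b'‖)
    (hd : dist b b' < δ) : 0 < euclInner b b' := by
  have hδ : 0 < δ := dist_nonneg.trans_lt hd
  have h1 := hb.trans (norm_le_euclNorm b)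
  have h2 := hb'.trans (norm_le_euclNorm b')
  have h3 : δ ^ 2 ≤ euclNorm b ^ 2 := pow_le_pow_left₀ hδ.le h1 2
  have h4 : δ ^ 2 ≤ euclNorm b' ^ 2 := pow_le_pow_left₀ hδ.le h2 2
  rw [euclNorm_sq] at h3 h4
  rw [dist_eq_norm] at hd
  have h5 : Complex.normSq (b.1 - b'.1) < δ ^ 2 := by
    rw [Complex.normSq_eq_norm_sq]
    exact pow_lt_pow_left₀ ((norm_fst_le (b - b')).trans_lt hd) (norm_nonneg _) two_ne_zero
  have h6 : (b.2 - b'.2) ^ 2 < δ ^ 2 := by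
    rw [← sq_abs]
    exact pow_lt_pow_left₀ ((norm_snd_le (b - b')).trans_lt hd) (abs_nonneg _) two_ne_zero
  simp only [euclInner, Complex.normSq_apply] at *
  simp at *
  nlinarith

theorem hopf_smul (r : ℝ) (z : ℂ × ℂ) : hopf (r • z) = (r ^ 2) • hopf z := by
  refine Prod.ext ?_ ?_
  · simp [hopf]; ring
  · simp [hopf]; ring

theorem exists_lift_hopf {Y : Type*} [PseudoMetricSpace Y] [CompactSpace Y]
    (H : Y → I → ℂ × ℝ) (hH : Continuous (Function.uncurry H)) (h0 : ∀ y t, H y t ≠ 0)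
    (L₀ : Y → ℂ × ℂ) (hL₀ : Continuous L₀) (hp₀ : ∀ y, hopf (L₀ y) = H y 0) :
    ∃ L : Y → I → ℂ × ℂ, Continuous (Function.uncurry L) ∧ (∀ y t, hopf (L y t) = H y t) ∧
      (∀ y, L y 0 = L₀ y) ∧ ∀ y, (∀ t, H y t = H y 0) → ∀ t, L y t = L₀ y := by
  obtain ⟨δ, hδ, hδH⟩ := exists_norm_lower_bound _ hH fun q => h0 q.1 q.2
  have hpos : ∀ b : ℂ × ℝ, δ ≤ ‖b‖ → 0 < euclNorm b := fun b hb =>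
    hδ.trans_le (hb.trans (norm_le_euclNorm b))
  have hmove : ∀ e b, δ ≤ ‖hopf e‖ → δ ≤ ‖b‖ → dist (hopf e) b < δ →
      0 < euclNorm (hopf (hopfMove e b)) := by
    intro e b he hb hd
    rw [euclNorm_hopf_hopfMove]
    have h1 := euclInner_pos hb he (by rwa [dist_comm])
    have h2 := hpos b hb
    have h3 := euclNorm_nonneg (hopf e)
    positivity
  refine exists_lift hopf {b | δ ≤ ‖b‖} hδ
    (fun e b => (√(euclNorm b) / √(euclNorm (hopf (hopfMove e b)))) • hopfMove e b) ?_ ?_ ?_ H hH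
    (fun y t => hδH (y, t)) L₀ hL₀ hp₀
  · have hc : Continuous fun q : (ℂ × ℂ) × (ℂ × ℝ) => hopfMove q.1 q.2 := by
      unfold hopfMove
      fun_prop
    refine ContinuousOn.smul (f := fun q : (ℂ × ℂ) × (ℂ × ℝ) =>
      √(euclNorm q.2) / √(euclNorm (hopf (hopfMove q.1 q.2))))
      (ContinuousOn.div ?_ ?_ ?_) hc.continuousOn
    · exact (by fun_prop : Continuous fun q : (ℂ × ℂ) × (ℂ × ℝ) => √(euclNorm q.2)).continuousOn
    · exact (((continuous_euclNorm.comp continuous_hopf).comp hc).sqrt).continuousOn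
    · intro q hq
      exact (Real.sqrt_pos.2 (hmove _ _ hq.1 hq.2.1 hq.2.2)).ne'
  · intro e b he hb hd
    have h1 := hmove e b he hb hd
    have h2 := hpos b hb
    rw [hopf_smul, div_pow, Real.sq_sqrt h2.le, Real.sq_sqrt h1.le, div_eq_inv_mul, mul_smul,
      euclNorm_smul_hopf_hopfMove, smul_smul, inv_mul_cancel₀ h1.ne', one_smul]
  · intro e he
    have h2 := hpos _ he
    simp only [hopfMove_hopf, hopf_smul]
    have h3 : euclNorm ((2 * euclNorm (hopf e)) ^ 2 • hopf e)
        = (2 * euclNorm (hopf e)) ^ 2 * euclNorm (hopf e) := by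
      rw [← hopf_smul, euclNorm_hopf, euclNorm_hopf]
      simp [Complex.normSq_apply]
      ring
    rw [h3, Real.sqrt_mul (by positivity), Real.sqrt_sq (by positivity), smul_smul]
    have h4 : 0 < √(euclNorm (hopf e)) := Real.sqrt_pos.2 h2
    rw [show √(euclNorm (hopf e)) / (2 * euclNorm (hopf e) * √(euclNorm (hopf e)))
      * (2 * euclNorm (hopf e)) = 1 by field_simp, one_smul]

/-- The ratio of two points in a fibre of the Hopf map. -/
def hopfRatio (z z' : ℂ × ℂ) : ℂ :=
  (z'.1 * conj z.1 + z'.2 * conj z.2) / (Complex.normSq z.1 + Complex.normSq z.2 : ℝ)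

theorem hopfRatio_spec {z z' : ℂ × ℂ} (hz : z ≠ 0) (h : hopf z = hopf z') :
    hopfRatio z z' • z = z' ∧ ‖hopfRatio z z'‖ = 1 := by
  have hn : euclNorm (hopf z) = euclNorm (hopf z') := by rw [h]
  rw [euclNorm_hopf, euclNorm_hopf] at hn
  have h1 : z.1 * conj z.2 = z'.1 * conj z'.2 := by
    have := congrArg Prod.fst h
    simp only [hopf, mul_assoc] at this
    exact mul_left_cancel₀ two_ne_zero this
  have h2 : Complex.normSq z.1 - Complex.normSq z.2 = Complex.normSq z'.1 - Complex.normSq z'.2 :=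
    congrArg Prod.snd h
  have h3 : z.1 * conj z.1 = z'.1 * conj z'.1 := by
    rw [Complex.mul_conj, Complex.mul_conj,
      show Complex.normSq z.1 = Complex.normSq z'.1 by linarith]
  have h4 : z.2 * conj z.2 = z'.2 * conj z'.2 := by
    rw [Complex.mul_conj, Complex.mul_conj,
      show Complex.normSq z.2 = Complex.normSq z'.2 by linarith]
  have h5 : z.2 * conj z.1 = z'.2 * conj z'.1 := by
    have := congrArg conj h1
    simp only [map_mul, Complex.conj_conj] at this
    linear_combination this
  have hpos : 0 < Complex.normSq z.1 + Complex.normSq z.2 := by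
    have h6 := Complex.normSq_nonneg z.1
    have h7 := Complex.normSq_nonneg z.2
    refine lt_of_le_of_ne (add_nonneg h6 h7) fun h0 => hz ?_
    exact Prod.ext (Complex.normSq_eq_zero.1 (by linarith)) (Complex.normSq_eq_zero.1 (by linarith))
  have hN : ((Complex.normSq z.1 + Complex.normSq z.2 : ℝ) : ℂ) ≠ 0 := by
    exact_mod_cast hpos.ne'
  have hN' : ((Complex.normSq z.1 + Complex.normSq z.2 : ℝ) : ℂ)
      = z'.1 * conj z'.1 + z'.2 * conj z'.2 := by
    rw [hn, Complex.mul_conj, Complex.mul_conj]; push_cast; rfl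
  have hsm : hopfRatio z z' • z = z' := by
    refine Prod.ext ?_ ?_
    · rw [Prod.smul_fst, smul_eq_mul, hopfRatio, div_mul_eq_mul_div, div_eq_iff hN, hN']
      linear_combination z'.1 * h3 + z'.2 * h1
    · rw [Prod.smul_snd, smul_eq_mul, hopfRatio, div_mul_eq_mul_div, div_eq_iff hN, hN']
      linear_combination z'.1 * h5 + z'.2 * h4
  refine ⟨hsm, ?_⟩
  have h8 : Complex.normSq (hopfRatio z z') = 1 := by
    have e1 := congrArg (fun u : ℂ × ℂ => Complex.normSq u.1 + Complex.normSq u.2) hsm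
    simp only [Prod.smul_fst, Prod.smul_snd, smul_eq_mul, map_mul] at e1
    have : (Complex.normSq (hopfRatio z z') - 1) *
        (Complex.normSq z.1 + Complex.normSq z.2) = 0 := by
      linear_combination e1 - hn
    rcases mul_eq_zero.1 this with h | h
    · linarith
    · exact absurd h hpos.ne'
  rw [Complex.normSq_eq_norm_sq] at h8
  exact (pow_eq_one_iff_of_nonneg (norm_nonneg _) two_ne_zero).1 h8

theorem hopf_unit_smul {c : ℂ} (hc : ‖c‖ = 1) (z : ℂ × ℂ) : hopf (c • z) = hopf z := by
  have h1 : c * conj c = 1 := by rw [Complex.mul_conj, Complex.normSq_eq_norm_sq, hc]; simp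
  have h2 : Complex.normSq c = 1 := by rw [Complex.normSq_eq_norm_sq, hc]; simp
  refine Prod.ext ?_ ?_
  · simp only [hopf, Prod.smul_fst, Prod.smul_snd, smul_eq_mul, map_mul]
    linear_combination (2 * z.1 * conj z.2) * h1
  · simp [hopf, h2]

theorem continuous_hopfRatio {Y : Type*} [TopologicalSpace Y] {f g : Y → ℂ × ℂ}
    (hf : Continuous f) (hg : Continuous g) (h0 : ∀ y, f y ≠ 0) :
    Continuous fun y => hopfRatio (f y) (g y) := by
  unfold hopfRatio
  refine Continuous.div (by fun_prop) (by fun_prop) fun y h => h0 y ?_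
  have h1 : Complex.normSq (f y).1 + Complex.normSq (f y).2 = 0 := by exact_mod_cast h
  have h6 := Complex.normSq_nonneg (f y).1
  have h7 := Complex.normSq_nonneg (f y).2
  exact Prod.ext (Complex.normSq_eq_zero.1 (by linarith)) (Complex.normSq_eq_zero.1 (by linarith))

theorem hopfRatio_self {z : ℂ × ℂ} (hz : z ≠ 0) : hopfRatio z z = 1 := by
  have h := (hopfRatio_spec hz rfl).1
  by_contra hne
  have : (hopfRatio z z - 1) • z = 0 := by rw [sub_smul, h]; simp
  exact (smul_ne_zero (sub_ne_zero.2 hne) hz) this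

end Hopf

/-- The nonzero vectors of `V`. -/
abbrev nz (V : Type*) [Zero V] : Set V := {y | y ≠ 0}

section Circle

theorem cls_exp_eq {k : ℕ} {a b : UnitCube k → ℂ} {x : nz ℂ}
    (ha : IsLoop (nz ℂ) x fun z => Complex.exp (a z))
    (hb : IsLoop (nz ℂ) x fun z => Complex.exp (b z))
    (hac : Continuous a) (hbc : Continuous b) (hab : ∀ z ∈ Cube.boundary (Fin k), a z = b z) :
    ha.cls = hb.cls := by
  refine (cls_eq_iff _ _).2
    ⟨fun r z => Complex.exp ((1 - (r : ℝ) : ℝ) * a z + (r : ℝ) * b z), ?_,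
      fun r z => Complex.exp_ne_zero _, ?_, ?_, fun r z hz => ?_⟩
  · unfold Function.uncurry; fun_prop
  · ext z; simp
  · ext z; simp
  · rw [← ha.bdry z hz]
    simp only [hab z hz]
    congr 1
    push_cast
    ring

/-- The exponent of the loop of degree `m`. -/
def windExp (m : ℤ) (z : UnitCube 1) : ℂ := (m * (z 0 : ℝ) : ℝ) * (2 * Real.pi * Complex.I)

theorem continuous_windExp (m : ℤ) : Continuous (windExp m) := by
  unfold windExp
  fun_prop

theorem boundary_one {z : UnitCube 1} (hz : z ∈ Cube.boundary (Fin 1)) : z 0 = 0 ∨ z 0 = 1 := by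
  obtain ⟨i, hi⟩ := hz
  rwa [Subsingleton.elim i 0] at hi

theorem isLoop_windExp (m : ℤ) :
    IsLoop (nz ℂ) ⟨1, one_ne_zero⟩ fun z => Complex.exp (windExp m z) := by
  refine ⟨(continuous_windExp m).cexp, fun z => Complex.exp_ne_zero _, fun z hz => ?_⟩
  rcases boundary_one hz with h | h
  · simp [windExp, h]
  · simp only [windExp, h]
    simp

theorem cls_windExp_add (m k : ℤ) :
    (isLoop_windExp (m + k)).cls = (isLoop_windExp m).cls * (isLoop_windExp k).cls := by
  rw [cls_mul 0]
  set a : UnitCube 1 → ℂ := fun z => (k * min (2 * (z 0 : ℝ)) 1 + m * max (2 * (z 0 : ℝ) - 1) 0 : ℝ)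
    * (2 * Real.pi * Complex.I) with ha
  have hEq : concat 0 (fun z => Complex.exp (windExp k z)) (fun z => Complex.exp (windExp m z))
      = fun z => Complex.exp (a z) := by
    ext z
    have h0 := (z 0).2.1
    have h1 := (z 0).2.2
    simp only [concat, windExp, ha, Function.update_self]
    split_ifs with h
    · rw [coe_clamp_of_mem ⟨by linarith, by linarith⟩, min_eq_left (by linarith),
        max_eq_right (by linarith)]
      simp
    · push Not at h
      rw [coe_clamp_of_mem ⟨by linarith, by linarith⟩, min_eq_right (by linarith),
        max_eq_left (by linarith)]
      push_cast
      rw [add_mul, Complex.exp_add, mul_one, Complex.exp_int_mul_two_pi_mul_I, one_mul]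
  have hal : IsLoop (nz ℂ) ⟨1, one_ne_zero⟩ fun z => Complex.exp (a z) := by
    rw [← hEq]
    exact (isLoop_windExp k).concat 0 (isLoop_windExp m)
  rw [cls_congr _ hal hEq]
  refine cls_exp_eq _ _ (continuous_windExp _) (by fun_prop) fun z hz => ?_
  rcases boundary_one hz with h | h
  · simp [windExp, ha, h]
  · simp only [windExp, ha, h]
    norm_num
    ring

theorem exists_piOne_equiv :
    Nonempty (HomotopyGroup (Fin 1) (nz ℂ) ⟨1, one_ne_zero⟩ ≃* Multiplicative ℤ) := by
  let φ : Multiplicative ℤ →* HomotopyGroup (Fin 1) (nz ℂ) ⟨1, one_ne_zero⟩ :=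
    MonoidHom.mk' (fun m => (isLoop_windExp m.toAdd).cls) fun m k => cls_windExp_add _ _
  refine ⟨(MulEquiv.ofBijective φ ⟨(injective_iff_map_eq_one φ).2 ?_, ?_⟩).symm⟩
  · intro m hm
    have hm' : (isLoop_windExp m.toAdd).cls = (isLoop_const (n := 1)).cls := hm
    obtain ⟨H, hc, hS, h0, h1, hb⟩ := (cls_eq_iff _ _).1 hm'
    obtain ⟨L, hLc, hLp, hL0, hLb⟩ := exists_lift_exp (fun z r => H r z)
      (hc.comp continuous_swap) (fun z r => hS r z) (windExp m.toAdd) (continuous_windExp _)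
      (fun z => (congrFun h0 z).symm)
    have hB : ∀ z ∈ Cube.boundary (Fin 1), L z 1 = windExp m.toAdd z := fun z hz =>
      hLb z (fun t => by simp only [hb _ z hz]) 1
    have h2 := eq_zero_of_exp_eq_one (L := fun z => L z 1)
      (hLc.comp (continuous_id.prodMk continuous_const))
      (fun z => by rw [hLp]; exact congrFun h1 z) (y₀ := fun _ => 0)
      (by rw [hB _ ⟨0, Or.inl rfl⟩]; simp [windExp]) (fun _ => 1)
    rw [hB _ ⟨0, Or.inr rfl⟩] at h2
    simp [windExp, Real.pi_ne_zero] at h2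
    exact h2
  · intro a
    obtain ⟨f, hf, rfl⟩ := exists_loop a
    have hfc := hf.cont
    obtain ⟨L, hLc, hLp, hL0, -⟩ := exists_lift_exp (fun (_ : Unit) (t : I) => f fun _ => t)
      (by unfold Function.uncurry; fun_prop) (fun _ t => hf.mem _) (fun _ => 0) continuous_const
      (fun _ => by rw [hf.bdry _ ⟨0, Or.inl rfl⟩]; simp)
    have hf1 : f (fun _ => 1) = 1 := hf.bdry _ ⟨0, Or.inr rfl⟩
    obtain ⟨m, hm⟩ := Complex.exp_eq_one_iff.1 ((hLp () 1).trans hf1)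
    have hz : ∀ z : UnitCube 1, z = fun _ => z 0 := fun z => by
      ext i; rw [Subsingleton.elim i 0]
    have hEq : f = fun z => Complex.exp (L () (z 0)) := by
      ext z
      rw [hLp, ← hz]
    have hloop : IsLoop (nz ℂ) ⟨1, one_ne_zero⟩ fun z => Complex.exp (L () (z 0)) := hEq ▸ hf
    refine ⟨Multiplicative.ofAdd m, ?_⟩
    rw [cls_congr hf hloop hEq]
    refine cls_exp_eq (isLoop_windExp _) hloop (continuous_windExp _)
      (hLc.comp (continuous_const.prodMk (continuous_apply 0))) fun z hz => ?_
    rcases boundary_one hz with h | h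
    · simp [windExp, h, hL0]
    · rw [h, hm]
      simp [windExp, h]

end Circle

section HopfIso

/-- Base point in the fibre of the Hopf map over `(1, 0)`. -/
def hopfBase : nz (ℂ × ℂ) := ⟨((√2⁻¹ : ℝ), (√2⁻¹ : ℝ)), by
  intro h
  have := congrArg Prod.fst h
  simp at this⟩

theorem hopf_hopfBase : hopf hopfBase = (1, 0) := by
  refine Prod.ext ?_ ?_
  · simp only [hopf, hopfBase, Complex.conj_ofReal]
    rw [mul_assoc, ← Complex.ofReal_mul, Real.mul_self_sqrt (by norm_num)]
    norm_num
  · simp [hopf, hopfBase]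

theorem basedMap_hopf :
    BasedMap (nz (ℂ × ℂ)) hopfBase (nz (ℂ × ℝ)) ⟨(1, 0), by simp⟩ hopf :=
  ⟨continuous_hopf.continuousOn, fun _ hz => hopf_ne_zero hz, hopf_hopfBase⟩

theorem ne_zero_of_hopf {z : ℂ × ℂ} (h : hopf z ≠ 0) : z ≠ 0 := by
  rintro rfl
  exact h hopf_zero

theorem norm_exp_mul_eq_one {θ : ℂ} (h : ‖Complex.exp θ‖ = 1) (r : ℝ) :
    ‖Complex.exp (r * θ)‖ = 1 := by
  rw [Complex.norm_exp] at h ⊢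
  have : θ.re = 0 := by simpa using h
  simp [this]

theorem exists_log_fibre {n : ℕ} (g : UnitCube (n + 2) → ℂ × ℂ) (hg : Continuous g)
    (hp : ∀ s, hopf (g s) = (1, 0)) (hb : ∀ s ∈ Cube.boundary (Fin (n + 2)), g s = hopfBase) :
    ∃ θ : UnitCube (n + 2) → ℂ, Continuous θ ∧ (∀ s, g s = Complex.exp (θ s) • (hopfBase : ℂ × ℂ)) ∧
      (∀ s, ‖Complex.exp (θ s)‖ = 1) ∧ ∀ s ∈ Cube.boundary (Fin (n + 2)), θ s = 0 := by
  have hr := fun s => hopfRatio_spec hopfBase.2 (z' := g s) (hopf_hopfBase.trans (hp s).symm)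
  obtain ⟨θ, hθ, hexp, hθb⟩ := exists_log_cube (fun s => hopfRatio hopfBase (g s))
    (continuous_hopfRatio continuous_const hg fun _ => hopfBase.2)
    (fun s h => by have := (hr s).2; rw [h] at this; simp at this)
    (fun s hs => by rw [hb s hs]; exact hopfRatio_self hopfBase.2)
  exact ⟨θ, hθ, fun s => by rw [hexp, (hr s).1], fun s => by rw [hexp, (hr s).2], hθb⟩

theorem mapHom_hopf_bijective (n : ℕ) : Function.Bijective (mapHom basedMap_hopf (n + 2)) := by
  refine ⟨(injective_iff_map_eq_one _).2 ?_, ?_⟩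
  · intro a ha
    obtain ⟨f, hf, rfl⟩ := exists_loop a
    rw [mapHom_cls, ← cls_const, cls_eq_iff] at ha
    obtain ⟨H, hc, hS, h0, h1, hb⟩ := ha
    obtain ⟨L, hLc, hLp, hL0, hLb⟩ := exists_lift_hopf (fun z r => H r z)
      (hc.comp continuous_swap) (fun z r => hS r z) f hf.cont (fun z => (congrFun h0 z).symm)
    have hB : ∀ z ∈ Cube.boundary (Fin (n + 3)), ∀ t, L z t = hopfBase := fun z hz t =>
      (hLb z (fun t => by simp only [hb _ z hz]) t).trans (hf.bdry z hz)
    have hg1 : IsLoop (nz (ℂ × ℂ)) hopfBase fun z => L z 1 :=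
      ⟨hLc.comp (continuous_id.prodMk continuous_const),
        fun z => ne_zero_of_hopf (by rw [hLp]; exact hS _ _), fun z hz => hB z hz 1⟩
    have hstep : hf.cls = hg1.cls := (cls_eq_iff _ _).2
      ⟨fun r z => L z r, hLc.comp continuous_swap,
        fun r z => ne_zero_of_hopf (by rw [hLp]; exact hS _ _), funext hL0, rfl,
        fun r z hz => hB z hz r⟩
    obtain ⟨θ, hθ, hgθ, hθn, hθb⟩ := exists_log_fibre _ hg1.cont
      (fun z => by rw [hLp]; exact congrFun h1 z) fun z hz => hB z hz 1
    rw [hstep, ← cls_const, cls_eq_iff]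
    refine ⟨fun r z => Complex.exp ((1 - (r : ℝ) : ℝ) * θ z) • (hopfBase : ℂ × ℂ),
      ?_, ?_, ?_, ?_, ?_⟩
    · unfold Function.uncurry; fun_prop
    · exact fun r z => smul_ne_zero (Complex.exp_ne_zero _) hopfBase.2
    · ext1 z; simp [hgθ]
    · ext1 z; simp
    · intro r z hz; simp [hθb z hz]
  · intro a
    obtain ⟨f, hf, rfl⟩ := exists_loop a
    obtain ⟨L, hLc, hLp, hL0, hLb⟩ := exists_lift_hopf
      (fun (s : UnitCube (n + 2)) (t : I) => f (Fin.cons t s))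
      (by unfold Function.uncurry; exact hf.cont.comp (continuous_cons_cube.comp continuous_swap))
      (fun s t => hf.mem _) (fun _ => (hopfBase : ℂ × ℂ)) continuous_const
      (fun s => by rw [hf.bdry _ (cons_mem_boundary.2 (Or.inl rfl)), hopf_hopfBase])
    have hLb' : ∀ s ∈ Cube.boundary (Fin (n + 2)), ∀ t, L s t = hopfBase := fun s hs t =>
      hLb s (fun t => by
        rw [hf.bdry _ (cons_mem_boundary.2 (Or.inr (Or.inr hs))),
          hf.bdry _ (cons_mem_boundary.2 (Or.inr (Or.inr hs)))]) t
    obtain ⟨θ, hθ, hgθ, hθn, hθb⟩ := exists_log_fibre (fun s => L s 1)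
      (hLc.comp (continuous_id.prodMk continuous_const))
      (fun s => by rw [hLp]; exact hf.bdry _ (cons_mem_boundary.2 (Or.inr (Or.inl rfl))))
      fun s hs => hLb' s hs 1
    set g : UnitCube (n + 3) → ℂ × ℂ := fun z =>
      Complex.exp ((-(z 0 : ℝ) : ℝ) * θ (Fin.tail z)) • L (Fin.tail z) (z 0) with hg
    have hhg : ∀ z, hopf (g z) = f z := fun z => by
      rw [hg]
      simp only
      rw [hopf_unit_smul (norm_exp_mul_eq_one (hθn _) _), hLp, Fin.cons_self_tail]
    have hgl : IsLoop (nz (ℂ × ℂ)) hopfBase g := by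
      refine ⟨?_, fun z => ne_zero_of_hopf (by rw [hhg]; exact hf.mem z), fun z hz => ?_⟩
      · have h1 : Continuous fun z : UnitCube (n + 3) => L (Fin.tail z) (z 0) :=
          hLc.comp (continuous_tail_cube.prodMk (continuous_apply 0))
        have h2 : Continuous fun z : UnitCube (n + 3) => θ (Fin.tail z) :=
          hθ.comp continuous_tail_cube
        fun_prop
      · simp only [hg]
        rcases mem_boundary_succ.1 hz with h | h | h
        · simp [h, hL0]
        · rw [h, hgθ, smul_smul, ← Complex.exp_add]
          simp
        · simp [hθb _ h, hLb' _ h]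
    exact ⟨hgl.cls, by rw [mapHom_cls]; exact cls_congr _ _ (funext hhg)⟩

end HopfIso

end TorusComplement

namespace TorusComplement

open Set Topology unitInterval Module

section GeneralPosition

variable {V : Type*} [NormedAddCommGroup V] [NormedSpace ℝ V]

/-- Interpolation between `a` and `b` that stays at `a` when `a = x₀` and equals `b` when `a` is
at distance at least `ε` from `x₀`. -/
def cutoff (x₀ : V) (ε : ℝ) (a b : V) : V := a + min 1 (‖a - x₀‖ / ε) • (b - a)

theorem continuous_cutoff (x₀ : V) (ε : ℝ) {Y : Type*} [TopologicalSpace Y] {f g : Y → V}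
    (hf : Continuous f) (hg : Continuous g) : Continuous fun y => cutoff x₀ ε (f y) (g y) := by
  unfold cutoff
  fun_prop

theorem cutoff_base {x₀ : V} {ε : ℝ} {a b : V} (h : a = x₀) : cutoff x₀ ε a b = x₀ := by
  simp [cutoff, h]

theorem cutoff_far {x₀ : V} {ε : ℝ} (hε : 0 < ε) {a b : V} (h : ε ≤ ‖a - x₀‖) :
    cutoff x₀ ε a b = b := by
  rw [cutoff, min_eq_left ((one_le_div hε).2 h)]
  simp

theorem norm_cutoff_sub_le {x₀ : V} {ε : ℝ} (hε : 0 < ε) (a b : V) :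
    ‖cutoff x₀ ε a b - a‖ ≤ ‖b - a‖ := by
  have h0 : 0 ≤ min 1 (‖a - x₀‖ / ε) := by positivity
  rw [cutoff, add_sub_cancel_left, norm_smul, Real.norm_of_nonneg h0]
  exact mul_le_of_le_one_left (norm_nonneg _) (min_le_left _ _)

variable [FiniteDimensional ℝ V]

theorem exists_avoiding {m : ℕ} (W : Submodule ℝ V) (hdim : m + finrank ℝ W < finrank ℝ V)
    (f : UnitCube m → V) (hf : Continuous f) (x₀ : V) {ε : ℝ} (hε : 0 < ε) :
    ∃ f' : UnitCube m → V, Continuous f' ∧ (∀ z, ‖f' z - f z‖ < ε) ∧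
      (∀ z, f z = x₀ → f' z = x₀) ∧ ∀ z, f' z ∈ W → ‖f z - x₀‖ < ε := by
  obtain ⟨g, hg, hgf, -⟩ := Continuous.exists_contDiff_approx (E := Fin m → ℝ)
    (f := fun z => f fun i => clamp (z i)) 1 (ε := fun _ => ε / 2) (by fun_prop) continuous_const
    (fun _ => half_pos hε)
  have hdense := ContDiff.dense_compl_range_of_finrank_lt_finrank
    (f := fun q : (Fin m → ℝ) × W => (q.2 : V) - g q.1)
    ((W.subtypeL.contDiff.comp contDiff_snd).sub (hg.comp contDiff_fst)) (by simpa using hdim)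
  obtain ⟨c, hc, hcε⟩ := hdense.exists_dist_lt 0 (half_pos hε)
  refine ⟨fun z => cutoff x₀ ε (f z) (g (fun i => z i) + c),
    continuous_cutoff _ _ hf (by fun_prop), fun z => ?_, fun z => cutoff_base, fun z hz => ?_⟩
  · refine (norm_cutoff_sub_le hε _ _).trans_lt ?_
    have h1 := hgf fun i => z i
    simp only [clamp_coe, dist_eq_norm] at h1
    rw [dist_comm, dist_zero_right] at hcε
    calc ‖g (fun i => z i) + c - f z‖ = ‖(g (fun i => z i) - f z) + c‖ := by congr 1; abel
      _ ≤ _ := norm_add_le _ _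
      _ < ε := by linarith
  · by_contra! h
    simp only [cutoff_far hε h] at hz
    exact hc ⟨(fun i => z i, ⟨_, hz⟩), by simp⟩

theorem exists_avoiding_pair {m : ℕ} (A B : Submodule ℝ V)
    (hdim : m + 2 + finrank ℝ A + finrank ℝ B < 2 * finrank ℝ V)
    (f : UnitCube (m + 1) → V) (hf : Continuous f) (x₀ : V) {ε : ℝ} (hε : 0 < ε) :
    ∃ f' : UnitCube (m + 1) → V, Continuous f' ∧ (∀ z, ‖f' z - f z‖ < ε) ∧
      (∀ z, f z = x₀ → f' z = x₀) ∧
      ∀ (s : UnitCube m) (t t' : I), t ≠ t' → f' (Fin.cons t s) ∈ A → f' (Fin.cons t' s) ∈ B →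
        ‖f (Fin.cons t s) - x₀‖ < ε ∨ ‖f (Fin.cons t' s) - x₀‖ < ε := by
  obtain ⟨g, hg, hgf, -⟩ := Continuous.exists_contDiff_approx (E := (Fin m → ℝ) × ℝ)
    (f := fun q => f (Fin.cons (clamp q.2) fun i => clamp (q.1 i))) 1 (ε := fun _ => ε / 2)
    (hf.comp (Continuous.finCons (by fun_prop) (by fun_prop))) continuous_const
    (fun _ => half_pos hε)
  let Q := (Fin m → ℝ) × ℝ × ℝ × A × B
  let c₂ : Q → V := fun q => (q.2.1 - q.2.2.1)⁻¹ •
    (((q.2.2.2.1 : V) - g (q.1, q.2.1)) - ((q.2.2.2.2 : V) - g (q.1, q.2.2.1)))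
  let c₁ : Q → V := fun q => (q.2.2.2.1 : V) - g (q.1, q.2.1) - q.2.1 • c₂ q
  let D₁ : Set Q := {q | q.2.1 - q.2.2.1 < 0}
  let D₂ : Set Q := {q | 0 < q.2.1 - q.2.2.1}
  have hsmooth : ∀ D : Set Q, (∀ q ∈ D, q.2.1 - q.2.2.1 ≠ 0) →
      ContDiffOn ℝ 1 (fun q => (c₁ q, c₂ q)) D := by
    intro D hD
    have ha : ContDiff ℝ 1 fun q : Q => (q.2.2.2.1 : V) := A.subtypeL.contDiff.comp (by fun_prop)
    have hb : ContDiff ℝ 1 fun q : Q => (q.2.2.2.2 : V) := B.subtypeL.contDiff.comp (by fun_prop)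
    have hga : ContDiff ℝ 1 fun q : Q => g (q.1, q.2.1) := hg.comp (by fun_prop)
    have hgb : ContDiff ℝ 1 fun q : Q => g (q.1, q.2.2.1) := hg.comp (by fun_prop)
    have ht : ContDiff ℝ 1 fun q : Q => q.2.1 := by fun_prop
    have ht' : ContDiff ℝ 1 fun q : Q => q.2.2.1 := by fun_prop
    have hc₂ : ContDiffOn ℝ 1 c₂ D :=
      ((ht.sub ht').contDiffOn.inv hD).smul ((ha.sub hga).sub (hb.sub hgb)).contDiffOn
    exact ((ha.sub hga).contDiffOn.sub (ht.contDiffOn.smul hc₂)).prodMk hc₂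
  have hQ : (finrank ℝ Q : ℕ) < finrank ℝ (V × V) := by
    simp only [Q, finrank_prod, finrank_fin_fun, finrank_self]
    omega
  have hdimD : ∀ D : Set Q, Convex ℝ D → (∀ q ∈ D, q.2.1 - q.2.2.1 ≠ 0) →
      dimH ((fun q => (c₁ q, c₂ q)) '' D) < finrank ℝ (V × V) := by
    intro D hconv hD
    refine ((hsmooth D hD).dimH_image_le hconv Subset.rfl).trans_lt ?_
    refine (dimH_mono (subset_univ _)).trans_lt ?_
    rw [Real.dimH_univ_eq_finrank]
    exact_mod_cast hQ
  have hlin : IsLinearMap ℝ fun q : Q => q.2.1 - q.2.2.1 :=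
    ⟨fun p q => by simp only [Q, Prod.snd_add, Prod.fst_add]; ring,
      fun c q => by simp only [Q, Prod.smul_snd, Prod.smul_fst, smul_eq_mul]; ring⟩
  have hdense := dense_compl_of_dimH_lt_finrank
    (s := (fun q => (c₁ q, c₂ q)) '' D₁ ∪ (fun q => (c₁ q, c₂ q)) '' D₂) (by
      rw [dimH_union]
      exact max_lt (hdimD _ (convex_halfSpace_lt hlin 0) fun q hq => ne_of_lt hq)
        (hdimD _ (convex_halfSpace_gt hlin 0) fun q hq => ne_of_gt hq))
  obtain ⟨⟨d₁, d₂⟩, hd, hdε⟩ := hdense.exists_dist_lt 0 (by positivity : (0 : ℝ) < ε / 4)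
  rw [dist_comm, dist_zero_right] at hdε
  have hd₁ : ‖d₁‖ < ε / 4 := (norm_fst_le (d₁, d₂)).trans_lt hdε
  have hd₂ : ‖d₂‖ < ε / 4 := (norm_snd_le (d₁, d₂)).trans_lt hdε
  let G : UnitCube (m + 1) → V := fun z =>
    g (fun i => (Fin.tail z i : ℝ), z 0) + d₁ + (z 0 : ℝ) • d₂
  have hG : Continuous G := by
    refine Continuous.add (Continuous.add (hg.continuous.comp ?_) continuous_const) (by fun_prop)
    unfold Fin.tail
    fun_prop
  refine ⟨fun z => cutoff x₀ ε (f z) (G z), continuous_cutoff _ _ hf hG, fun z => ?_,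
    fun z => cutoff_base, fun s t t' htt ha hb => ?_⟩
  · refine (norm_cutoff_sub_le hε _ _).trans_lt ?_
    have h1 := hgf (fun i => (Fin.tail z i : ℝ), z 0)
    simp only [clamp_coe, dist_eq_norm] at h1
    have h2 : (Fin.cons (z 0) fun i => Fin.tail z i : UnitCube (m + 1)) = z := Fin.cons_self_tail z
    rw [h2] at h1
    have h3 : ‖(z 0 : ℝ) • d₂‖ ≤ ‖d₂‖ := by
      rw [norm_smul, Real.norm_of_nonneg (z 0).2.1]
      exact mul_le_of_le_one_left (norm_nonneg _) (z 0).2.2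
    calc ‖G z - f z‖ = ‖(g (fun i => (Fin.tail z i : ℝ), z 0) - f z) + (d₁ + (z 0 : ℝ) • d₂)‖ := by
          congr 1; simp only [G]; abel
      _ ≤ _ := norm_add_le _ _
      _ ≤ _ := add_le_add_right (norm_add_le _ _) _
      _ < ε := by linarith
  · by_contra! h
    simp only [cutoff_far hε h.1] at ha
    simp only [cutoff_far hε h.2] at hb
    simp only [G, Fin.tail_cons, Fin.cons_zero] at ha hb
    let q : Q := (fun i => s i, t, t', ⟨_, ha⟩, ⟨_, hb⟩)
    have hne : (t : ℝ) - t' ≠ 0 := sub_ne_zero.2 fun h => htt (Subtype.ext h)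
    have e₂ : c₂ q = d₂ := by
      simp only [c₂, q]
      rw [inv_smul_eq_iff₀ hne]
      module
    have e₁ : c₁ q = d₁ := by
      simp only [c₁, e₂]
      simp only [q]
      abel
    refine hd ?_
    have e : (c₁ q, c₂ q) = (d₁, d₂) := by rw [e₁, e₂]
    rcases lt_or_gt_of_ne hne with h | h
    · exact Or.inl ⟨q, h, e⟩
    · exact Or.inr ⟨q, h, e⟩

end GeneralPosition

section Separation

variable {V : Type*}

theorem exists_separating {n : ℕ} (F : UnitCube (n + 1) → V) {A B : Set V}
    (hA : IsClosed (F ⁻¹' A)) (hB : IsClosed (F ⁻¹' B))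
    (h : ∀ s t t', F (Fin.cons t s) ∈ A → F (Fin.cons t' s) ∈ B → False) :
    ∃ τ : UnitCube n → ℝ, Continuous τ ∧ (∀ s, τ s ∈ Icc (0 : ℝ) 1) ∧
      (∀ t s, F (Fin.cons t s) ∈ A → τ s = 1) ∧ ∀ t s, F (Fin.cons t s) ∈ B → τ s = 0 := by
  have hd : Disjoint (Fin.tail '' (F ⁻¹' B) : Set (UnitCube n)) (Fin.tail '' (F ⁻¹' A)) := by
    rw [Set.disjoint_left]
    rintro _ ⟨z, hz, rfl⟩ ⟨y, hy, hyz⟩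
    refine h (Fin.tail z) (y 0) (z 0) ?_ ?_
    · rw [← hyz, Fin.cons_self_tail]; exact hy
    · rw [Fin.cons_self_tail]; exact hz
  obtain ⟨τ, h0, h1, hτ⟩ := exists_continuous_zero_one_of_isClosed
    (hB.isCompact.image continuous_tail_cube).isClosed
    (hA.isCompact.image continuous_tail_cube).isClosed hd
  exact ⟨τ, τ.continuous, hτ, fun t s hs => h1 ⟨_, hs, Fin.tail_cons _ _⟩,
    fun t s hs => h0 ⟨_, hs, Fin.tail_cons _ _⟩⟩

end Separation

section Representatives

variable {V : Type*} [NormedAddCommGroup V] [NormedSpace ℝ V] {n : ℕ} {S : Set V} {x : S}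

omit [NormedSpace ℝ V] in
theorem isClosed_preimage_of_isOpen_diff {f : UnitCube n → V} (hf : IsLoop S x f) {A : Set V}
    (hA : IsOpen (S \ A)) : IsClosed (f ⁻¹' A) := by
  have : f ⁻¹' A = (f ⁻¹' (S \ A))ᶜ := by
    ext z
    simp [hf.mem z]
  rw [this]
  exact (hA.preimage hf.cont).isClosed_compl

/-- Maps close to a loop are loops in the same class. -/
theorem exists_close {f : UnitCube n → V} (hS : IsOpen S) (hf : IsLoop S x f) {U : Set V}
    (hU : IsOpen U) (hx : (x : V) ∈ U) :
    ∃ ε > 0, (∀ y : V, ‖y - x‖ < 2 * ε → y ∈ U) ∧ ∀ g : UnitCube n → V, Continuous g →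
      (∀ z, ‖g z - f z‖ < ε) → (∀ z, f z = x → g z = x) → ∃ hg : IsLoop S x g, hg.cls = hf.cls := by
  obtain ⟨δ, hδ, hδS⟩ := (isCompact_range hf.cont).exists_thickening_subset_open hS
    (range_subset_iff.2 hf.mem)
  obtain ⟨η, hη, hηU⟩ := Metric.isOpen_iff.1 hU x hx
  refine ⟨min δ (η / 2), by positivity, fun y hy => hηU ?_, fun g hgc hgf hgx => ?_⟩
  · rw [Metric.mem_ball, dist_eq_norm]
    linarith [min_le_right δ (η / 2)]
  have key : ∀ z y, ‖y - f z‖ < δ → y ∈ S := fun z y hy =>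
    hδS (Metric.mem_thickening_iff.2 ⟨f z, mem_range_self z, by rwa [dist_eq_norm]⟩)
  have hgδ : ∀ z, ‖g z - f z‖ < δ := fun z => (hgf z).trans_le (min_le_left _ _)
  have hg : IsLoop S x g := ⟨hgc, fun z => key z _ (hgδ z), fun z hz => hgx z (hf.bdry z hz)⟩
  refine ⟨hg, (cls_eq_of_segment hf hg fun z r hr => key z _ ?_).symm⟩
  have : (1 - r) • f z + r • g z - f z = r • (g z - f z) := by module
  rw [this, norm_smul, Real.norm_of_nonneg hr.1]
  nlinarith [hgδ z, norm_nonneg (g z - f z), hr.1, hr.2]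

theorem exists_rep_avoiding [FiniteDimensional ℝ V] (hS : IsOpen S) {D : Set V}
    (W : Submodule ℝ V) (hdim : n + finrank ℝ W < finrank ℝ V) (hDW : D ⊆ W)
    (hD : IsOpen (S \ D)) (hx : (x : V) ∉ D) {f : UnitCube n → V} (hf : IsLoop S x f) :
    ∃ g, ∃ hg : IsLoop S x g, hg.cls = hf.cls ∧ ∀ z, g z ∉ D := by
  obtain ⟨ε, hε, hU, hg⟩ := exists_close hS hf hD ⟨x.2, hx⟩
  obtain ⟨g, hgc, hgf, hgx, hgW⟩ := exists_avoiding W hdim f hf.cont (x : V) hε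
  obtain ⟨hg, hcls⟩ := hg g hgc hgf hgx
  refine ⟨g, hg, hcls, fun z hz => (hU (g z) ?_).2 hz⟩
  have h1 := hgW z (hDW hz)
  have h2 := hgf z
  have h3 := norm_add_le (g z - f z) (f z - x)
  rw [sub_add_sub_cancel] at h3
  linarith

/-- A loop can be deformed so that its lower half avoids `A` and its upper half avoids `B`. -/
theorem exists_rep_separated [FiniteDimensional ℝ V] (hS : IsOpen S) {A B : Set V}
    (WA WB : Submodule ℝ V) (hdim : n + 2 + finrank ℝ WA + finrank ℝ WB < 2 * finrank ℝ V)
    (hAW : A ⊆ WA) (hBW : B ⊆ WB) (hA : IsOpen (S \ A)) (hB : IsOpen (S \ B))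
    (hxA : (x : V) ∉ A) (hxB : (x : V) ∉ B) (hAB : Disjoint A B)
    {f : UnitCube (n + 1) → V} (hf : IsLoop S x f) :
    ∃ g, ∃ hg : IsLoop S x g, hg.cls = hf.cls ∧
      (∀ z, (z 0 : ℝ) ≤ 1 / 2 → g z ∉ A) ∧ ∀ z, 1 / 2 ≤ (z 0 : ℝ) → g z ∉ B := by
  obtain ⟨ε, hε, hU, hg⟩ := exists_close hS hf (hA.inter hB) ⟨⟨x.2, hxA⟩, x.2, hxB⟩
  obtain ⟨g, hgc, hgf, hgx, hgAB⟩ := exists_avoiding_pair WA WB hdim f hf.cont (x : V) hε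
  obtain ⟨hg, hcls⟩ := hg g hgc hgf hgx
  have hnear : ∀ z, ‖f z - x‖ < ε → g z ∈ S \ A ∩ (S \ B) := fun z hz => hU (g z) (by
    have h2 := hgf z
    have h3 := norm_add_le (g z - f z) (f z - x)
    rw [sub_add_sub_cancel] at h3
    linarith)
  obtain ⟨τ, hτc, hτ, hτA, hτB⟩ := exists_separating g (isClosed_preimage_of_isOpen_diff hg hA)
    (isClosed_preimage_of_isOpen_diff hg hB) fun s t t' h1 h2 => by
      by_cases htt : t = t'
      · subst htt
        exact Set.disjoint_left.1 hAB h1 h2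
      · rcases hgAB s t t' htt (hAW h1) (hBW h2) with h | h
        · exact (hnear _ h).1.2 h1
        · exact (hnear _ h).2.2 h2
  let H : I → UnitCube (n + 1) → V := fun r z => g (Fin.cons
    (clamp ((1 - r) * z 0 + r * (2 * z 0 - τ (Fin.tail z)))) (Fin.tail z))
  have hHc : Continuous (Function.uncurry H) := by
    refine hgc.comp (continuous_cons_cube.comp (Continuous.prodMk ?_ ?_))
    · have := hτc.comp (continuous_tail_cube.comp (continuous_snd (X := I)))
      simp only [Function.comp_def] at this
      fun_prop
    · exact continuous_tail_cube.comp continuous_snd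
  have hHb : ∀ r, ∀ z ∈ Cube.boundary (Fin (n + 1)), H r z = x := by
    intro r z hz
    refine hg.bdry _ (cons_mem_boundary.2 ?_)
    rcases mem_boundary_succ.1 hz with h | h | h
    · refine Or.inl (clamp_of_le ?_)
      rw [h]
      simpa using mul_nonneg r.2.1 (hτ _).1
    · refine Or.inr (Or.inl (clamp_of_ge ?_))
      rw [h]
      simp only [Icc.coe_one]
      nlinarith [r.2.1, (hτ (Fin.tail z)).2]
    · exact Or.inr (Or.inr h)
  have hH0 : H 0 = g := by
    funext z
    simp [H, Fin.cons_self_tail]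
  have hH1 : IsLoop S x (H 1) :=
    ⟨hHc.comp (Continuous.prodMk_right (1 : I)), fun z => hg.mem _, hHb 1⟩
  refine ⟨H 1, hH1, ?_, fun z hz hzA => ?_, fun z hz hzB => ?_⟩
  · rw [← hcls]
    exact ((cls_eq_iff hg hH1).2 ⟨H, hHc, fun r z => hg.mem _, hH0, rfl, hHb⟩).symm
  · have h1 := hτA _ _ hzA
    have h2 : H 1 z = x := by
      refine hg.bdry _ (cons_mem_boundary.2 (Or.inl (clamp_of_le ?_)))
      rw [h1]
      simp only [Icc.coe_one]
      linarith
    exact hxA (h2 ▸ hzA)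
  · have h1 := hτB _ _ hzB
    have h2 : H 1 z = x := by
      refine hg.bdry _ (cons_mem_boundary.2 (Or.inr (Or.inl (clamp_of_ge ?_))))
      rw [h1]
      simp only [Icc.coe_one]
      linarith
    exact hxB (h2 ▸ hzB)

end Representatives

section LinearIso

variable {V V' : Type*} [NormedAddCommGroup V] [NormedSpace ℝ V] [NormedAddCommGroup V']
  [NormedSpace ℝ V']

theorem mapHom_mapHom {V V' : Type*} [TopologicalSpace V] [TopologicalSpace V'] {n : ℕ}
    {S : Set V} {x : S} {S' : Set V'} {x' : S'} {φ : V → V'} {ψ : V' → V}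
    (hφ : BasedMap S x S' x' φ) (hψ : BasedMap S' x' S x ψ)
    (h : ∀ y ∈ S, ψ (φ y) = y) (a : HomotopyGroup (Fin (n + 1)) S x) :
    mapHom hψ n (mapHom hφ n a) = a := by
  obtain ⟨f, hf, rfl⟩ := exists_loop a
  rw [mapHom_cls, mapHom_cls]
  exact cls_congr _ _ (funext fun z => h _ (hf.mem z))

theorem exists_equiv_nz [FiniteDimensional ℝ V] [FiniteDimensional ℝ V']
    (h : finrank ℝ V = finrank ℝ V') (x : nz V) (x' : nz V') (n : ℕ) :
    Nonempty (HomotopyGroup (Fin (n + 1)) (nz V) x ≃* HomotopyGroup (Fin (n + 1)) (nz V') x') := by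
  let e := ContinuousLinearEquiv.ofFinrankEq h
  obtain ⟨A, hA⟩ := SeparatingDual.exists_continuousLinearEquiv_apply_eq (R := ℝ)
    (x := e x) (y := (x' : V')) ((map_ne_zero_iff e e.injective).2 x.2) x'.2
  let L := e.trans A
  have hL : BasedMap (nz V) x (nz V') x' L := ⟨L.continuous.continuousOn,
    fun y hy => by simpa using hy, hA⟩
  have hL' : BasedMap (nz V') x' (nz V) x L.symm := ⟨L.symm.continuous.continuousOn,
    fun y hy => by simpa using hy, by rw [L.symm_apply_eq]; exact hA.symm⟩
  exact ⟨MulEquiv.mk ⟨mapHom hL n, mapHom hL' n,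
    mapHom_mapHom hL hL' fun y _ => L.symm_apply_apply y,
    mapHom_mapHom hL' hL fun y _ => L.apply_symm_apply y⟩ (map_mul (mapHom hL n))⟩

end LinearIso

section Suspension

variable {F : Type*} [NormedAddCommGroup F] [NormedSpace ℝ F]

/-- The point at height `t` of the suspension line through `y`, as a point of `F × ℝ`; the lines
join in `(y₀, 0)`. -/
def susp (y₀ y : F) (t : ℝ) : F × ℝ :=
  (y₀ + (1 - |2 * t - 1|) • (y - y₀), (1 - |2 * t - 1|) * (2 * t - 1) * ‖y - y₀‖)

theorem continuous_susp {Y : Type*} [TopologicalSpace Y] (y₀ : F) {f : Y → F} {t : Y → ℝ}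
    (hf : Continuous f) (ht : Continuous t) : Continuous fun y => susp y₀ (f y) (t y) := by
  unfold susp
  fun_prop

theorem susp_zero (y₀ y : F) : susp y₀ y 0 = (y₀, 0) := by simp [susp]

theorem susp_one (y₀ y : F) : susp y₀ y 1 = (y₀, 0) := by
  norm_num [susp]

theorem susp_half (y₀ y : F) : susp y₀ y (1 / 2) = (y, 0) := by simp [susp]

theorem susp_self (y₀ : F) (t : ℝ) : susp y₀ y₀ t = (y₀, 0) := by simp [susp]

theorem susp_ne_zero {y₀ y : F} (h₀ : y₀ ≠ 0) (h : y ≠ 0) (t : ℝ) : susp y₀ y t ≠ 0 := by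
  intro h0
  obtain ⟨h1, h2⟩ := Prod.mk_eq_zero.1 h0
  rcases mul_eq_zero.1 h2 with h2 | h2
  · rcases mul_eq_zero.1 h2 with h2 | h2
    · exact h₀ (by simpa [h2] using h1)
    · exact h (by simpa [h2] using h1)
  · rw [norm_eq_zero] at h2
    exact h₀ (by simpa [h2] using h1)

/-- The suspension of a loop. -/
def suspLoop {n : ℕ} (y₀ : F) (f : UnitCube n → F) (z : UnitCube (n + 1)) : F × ℝ :=
  susp y₀ (f (Fin.tail z)) (z 0)

/-- The base point `(y₀, 0)` of the nonzero vectors of `F × ℝ`. -/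
def suspBase (y₀ : nz F) : nz (F × ℝ) := ⟨(y₀, 0), fun h => y₀.2 (Prod.mk_eq_zero.1 h).1⟩

theorem susp_boundary {n : ℕ} {y₀ : nz F} {f : UnitCube n → F}
    (hf : ∀ s ∈ Cube.boundary (Fin n), f s = y₀) {z : UnitCube (n + 1)}
    (hz : z ∈ Cube.boundary (Fin (n + 1))) : suspLoop (y₀ : F) f z = suspBase y₀ := by
  unfold suspLoop suspBase
  rcases mem_boundary_succ.1 hz with h | h | h
  · rw [h]; exact susp_zero _ _
  · rw [h]; exact susp_one _ _
  · rw [hf _ h]; exact susp_self _ _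

theorem isLoop_suspLoop {n : ℕ} {y₀ : nz F} {f : UnitCube n → F} (hf : IsLoop (nz F) y₀ f) :
    IsLoop (nz (F × ℝ)) (suspBase y₀) (suspLoop (y₀ : F) f) :=
  ⟨continuous_susp _ (hf.cont.comp continuous_tail_cube) (by fun_prop),
    fun z => susp_ne_zero y₀.2 (hf.mem _) _, fun _ hz => susp_boundary hf.bdry hz⟩

theorem exists_suspHom (y₀ : nz F) (n : ℕ) :
    ∃ φ : HomotopyGroup (Fin (n + 1)) (nz F) y₀ →*
        HomotopyGroup (Fin (n + 2)) (nz (F × ℝ)) (suspBase y₀),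
      ∀ f (hf : IsLoop (nz F) y₀ f), φ hf.cls = (isLoop_suspLoop hf).cls := by
  refine exists_hom (suspLoop (y₀ : F)) (fun f hf => isLoop_suspLoop hf) ?_ 0 1 ?_
  · rintro f g - - ⟨H, hc, hS, rfl, rfl, hb⟩
    refine ⟨fun r z => suspLoop (y₀ : F) (H r) z, ?_, fun r z => susp_ne_zero y₀.2 (hS _ _) _,
      rfl, rfl, fun r z hz => susp_boundary (hb r) hz⟩
    exact continuous_susp _ (hc.comp (continuous_fst.prodMk
      (continuous_tail_cube.comp continuous_snd))) (by fun_prop)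
  · intro f g _ _
    ext1 z
    have h1 : (Fin.tail z : UnitCube (n + 1)) 0 = z 1 := rfl
    have h2 : ∀ a : I, Fin.tail (Function.update z 1 a) = Function.update (Fin.tail z) 0 a :=
      fun a => Fin.tail_update_succ (α := fun _ => I) z 0 a
    have h3 : ∀ a : I, Function.update z 1 a 0 = z 0 := fun a => Function.update_of_ne (by simp) _ _
    simp only [suspLoop, concat, h1, h2, h3]
    split_ifs <;> rfl

/-- The suspension homomorphism. -/
def suspHom (y₀ : nz F) (n : ℕ) : HomotopyGroup (Fin (n + 1)) (nz F) y₀ →*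
    HomotopyGroup (Fin (n + 2)) (nz (F × ℝ)) (suspBase y₀) :=
  (exists_suspHom y₀ n).choose

theorem suspHom_cls {y₀ : nz F} {n : ℕ} {f : UnitCube (n + 1) → F} (hf : IsLoop (nz F) y₀ f) :
    suspHom y₀ n hf.cls = (isLoop_suspLoop hf).cls :=
  (exists_suspHom y₀ n).choose_spec f hf

theorem finrank_snd_line :
    finrank ℝ (LinearMap.ker (LinearMap.fst ℝ F ℝ)) = 1 := by
  rw [LinearMap.ker_fst, LinearMap.finrank_range_of_inj LinearMap.inr_injective, finrank_self]

omit [NormedSpace ℝ F] in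
theorem isOpen_nz_diff_pos : IsOpen (nz (F × ℝ) \ {p | p.1 = 0 ∧ 0 < p.2}) := by
  have : nz (F × ℝ) \ {p | p.1 = 0 ∧ 0 < p.2} = {p | p.1 ≠ 0} ∪ {p | p.2 < 0} := by
    ext ⟨y, h⟩
    by_cases hy : y = 0 <;> simp [hy]
    grind
  rw [this]
  exact (isOpen_ne_fun continuous_fst continuous_const).union
    (isOpen_lt continuous_snd continuous_const)

omit [NormedSpace ℝ F] in
theorem isOpen_nz_diff_neg : IsOpen (nz (F × ℝ) \ {p | p.1 = 0 ∧ p.2 < 0}) := by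
  have : nz (F × ℝ) \ {p | p.1 = 0 ∧ p.2 < 0} = {p | p.1 ≠ 0} ∪ {p | 0 < p.2} := by
    ext ⟨y, h⟩
    by_cases hy : y = 0 <;> simp [hy]
    grind
  rw [this]
  exact (isOpen_ne_fun continuous_fst continuous_const).union
    (isOpen_lt continuous_const continuous_snd)

theorem suspHom_surjective [FiniteDimensional ℝ F] (y₀ : nz F) {n : ℕ}
    (hn : n + 3 < 2 * finrank ℝ F) : Function.Surjective (suspHom y₀ n) := by
  intro a
  obtain ⟨f, hf, rfl⟩ := exists_loop a
  obtain ⟨g, hg, hcls, hgA, hgB⟩ := exists_rep_separated (S := nz (F × ℝ))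
    (A := {p | p.1 = 0 ∧ 0 < p.2}) (B := {p | p.1 = 0 ∧ p.2 < 0}) isOpen_ne
    (LinearMap.ker (LinearMap.fst ℝ F ℝ)) (LinearMap.ker (LinearMap.fst ℝ F ℝ))
    (by rw [finrank_snd_line, finrank_prod, finrank_self]; omega) (fun p hp => hp.1)
    (fun p hp => hp.1)
    isOpen_nz_diff_pos isOpen_nz_diff_neg
    (fun h => y₀.2 h.1) (fun h => y₀.2 h.1)
    (Set.disjoint_left.2 fun p h1 h2 => lt_asymm h1.2 h2.2) hf
  have hgc := hg.cont
  let half : I := ⟨1 / 2, by norm_num, by norm_num⟩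
  let ρ : UnitCube (n + 1) → F := fun s => (g (Fin.cons half s)).1
  have hlow : ∀ z, (z 0 : ℝ) ≤ 1 / 2 → (g z).1 = 0 → (g z).2 < 0 := fun z hz h0 => by
    have h1 := hgA z hz
    have h2 := hg.mem z
    simp only [mem_ofPred_eq, h0, true_and, not_lt] at h1
    exact lt_of_le_of_ne h1 fun h => h2 (Prod.ext h0 h)
  have hupp : ∀ z, 1 / 2 ≤ (z 0 : ℝ) → (g z).1 = 0 → 0 < (g z).2 := fun z hz h0 => by
    have h1 := hgB z hz
    have h2 := hg.mem z
    simp only [mem_ofPred_eq, h0, true_and, not_lt] at h1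
    exact lt_of_le_of_ne h1 fun h => h2 (Prod.ext h0 h.symm)
  have hmid : ∀ z, (z 0 : ℝ) = 1 / 2 → (g z).1 ≠ 0 := fun z hz h0 =>
    lt_asymm (hlow z hz.le h0) (hupp z hz.ge h0)
  have hρ : IsLoop (nz F) y₀ ρ := by
    refine ⟨by fun_prop, fun s => hmid _ rfl, fun s hs => ?_⟩
    change (g _).1 = _
    rw [hg.bdry _ (cons_mem_boundary.2 (Or.inr (Or.inr hs)))]
    rfl
  let g' : UnitCube (n + 2) → F × ℝ := fun z =>
    ((g z).1, (2 * z 0 - 1) * (|(g z).2| + ‖(g z).1 - y₀‖))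
  have hg'0 : ∀ z, ∀ r ∈ Icc (0 : ℝ) 1, (1 - r) • g z + r • g' z ∈ nz (F × ℝ) := by
    intro z r hr h0
    obtain ⟨h1, h2⟩ := Prod.ext_iff.1 h0
    have h1' : (g z).1 = 0 := by
      simpa [g', ← add_smul] using h1
    have hy : 0 < ‖(y₀ : F)‖ := norm_pos_iff.2 y₀.2
    simp only [g', h1', Prod.snd_add, Prod.smul_snd, smul_eq_mul, Prod.snd_zero, zero_sub,
      norm_neg] at h2
    have hpos : 0 < |(g z).2| + ‖(y₀ : F)‖ := by positivity
    obtain ⟨hr0, hr1⟩ := hr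
    rcases lt_trichotomy ((z 0 : ℝ)) (1 / 2) with h | h | h
    · have h3 := hlow z h.le h1'
      have h4 : (2 * (z 0 : ℝ) - 1) * (|(g z).2| + ‖(y₀ : F)‖) < 0 :=
        mul_neg_of_neg_of_pos (by linarith) hpos
      rcases hr1.lt_or_eq with h5 | h5
      · nlinarith
      · subst h5; linarith
    · exact hmid z h h1'
    · have h3 := hupp z h.le h1'
      have h4 : 0 < (2 * (z 0 : ℝ) - 1) * (|(g z).2| + ‖(y₀ : F)‖) :=
        mul_pos (by linarith) hpos
      rcases hr1.lt_or_eq with h5 | h5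
      · nlinarith
      · subst h5; linarith
  have hg' : IsLoop (nz (F × ℝ)) (suspBase y₀) g' := by
    refine ⟨by fun_prop, fun z => by simpa using hg'0 z 1 (by simp), fun z hz => ?_⟩
    simp [g', hg.bdry z hz, suspBase]
  refine ⟨hρ.cls, ?_⟩
  rw [suspHom_cls, ← hcls, cls_eq_of_segment hg hg' hg'0]
  refine (cls_eq_of_segment hg' (isLoop_suspLoop hρ) fun z r hr h0 => ?_).symm
  obtain ⟨h1, h2⟩ := Prod.ext_iff.1 h0
  simp only [g', suspLoop, susp, Prod.snd_add, Prod.fst_add, Prod.smul_snd, Prod.smul_fst,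
    smul_eq_mul, Prod.snd_zero, Prod.fst_zero] at h1 h2
  obtain ⟨hr0, hr1⟩ := hr
  have hm : 0 ≤ 1 - |2 * (z 0 : ℝ) - 1| := by
    have := (z 0).2.1
    have := (z 0).2.2
    rw [sub_nonneg, abs_le]
    constructor <;> linarith
  by_cases ht : 2 * (z 0 : ℝ) - 1 = 0
  · have h3 : ρ (Fin.tail z) = (g z).1 := by
      have : half = z 0 := Subtype.ext (by change (1 / 2 : ℝ) = _; linarith)
      simp only [ρ, this, Fin.cons_self_tail]
    rw [ht, h3] at h1
    refine hmid z (by linarith) ?_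
    simpa [← add_smul] using h1
  · have h3 : (1 - r) * (|(g z).2| + ‖(g z).1 - y₀‖) +
        r * ((1 - |2 * (z 0 : ℝ) - 1|) * ‖ρ (Fin.tail z) - y₀‖) = 0 := by
      refine (mul_eq_zero.1 ?_).resolve_left ht
      linear_combination h2
    have h4 : 0 ≤ (1 - r) * (|(g z).2| + ‖(g z).1 - y₀‖) :=
      mul_nonneg (by linarith) (by positivity)
    have h5 : 0 ≤ r * ((1 - |2 * (z 0 : ℝ) - 1|) * ‖ρ (Fin.tail z) - y₀‖) := by positivity
    have h6 : (1 - r) * (|(g z).2| + ‖(g z).1 - y₀‖) = 0 := by linarith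
    have h7 : r * ((1 - |2 * (z 0 : ℝ) - 1|) * ‖ρ (Fin.tail z) - y₀‖) = 0 := by linarith
    have h8 : (1 - r) • ((g z).1 - y₀) = 0 := by
      rcases mul_eq_zero.1 h6 with h | h
      · rw [h, zero_smul]
      · have := abs_nonneg (g z).2
        have := norm_nonneg ((g z).1 - y₀)
        rw [norm_eq_zero.1 (show ‖(g z).1 - (y₀ : F)‖ = 0 by linarith), smul_zero]
    have h9 : (r * (1 - |2 * (z 0 : ℝ) - 1|)) • (ρ (Fin.tail z) - y₀) = 0 := by
      rw [← mul_assoc] at h7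
      rcases mul_eq_zero.1 h7 with h | h
      · rw [h, zero_smul]
      · rw [norm_eq_zero.1 h, smul_zero]
    refine y₀.2 ?_
    have : (y₀ : F) = (1 - r) • (g z).1 + r • ((y₀ : F) + (1 - |2 * (z 0 : ℝ) - 1|) •
      (ρ (Fin.tail z) - y₀)) - (1 - r) • ((g z).1 - y₀) -
      (r * (1 - |2 * (z 0 : ℝ) - 1|)) • (ρ (Fin.tail z) - y₀) := by module
    rw [this, h1, h8, h9]
    simp

end Suspension

section SuspensionInjective

variable {F : Type*} [NormedAddCommGroup F] [NormedSpace ℝ F]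

theorem suspHom_injective_of (y₀ : nz F) (n : ℕ)
    (h : ∀ f, IsLoop (nz F) y₀ f → LoopHomotopic (nz (F × ℝ)) (suspBase y₀)
      (suspLoop (n := n + 1) (y₀ : F) f) (fun _ => suspBase y₀) →
      LoopHomotopic (nz F) y₀ f (fun _ => y₀)) : Function.Injective (suspHom y₀ n) := by
  rw [injective_iff_map_eq_one]
  intro a ha
  obtain ⟨f, hf, rfl⟩ := exists_loop a
  rw [suspHom_cls, ← cls_const, cls_eq_iff] at ha
  rw [← cls_const, cls_eq_iff]
  exact h f hf ha

theorem suspHom_injective [FiniteDimensional ℝ F] (y₀ : nz F) {n : ℕ}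
    (hn : n + 4 < 2 * finrank ℝ F) : Function.Injective (suspHom y₀ n) := by
  refine suspHom_injective_of y₀ n fun f hf ⟨H, hHc, hHS, hH0, hH1, hHb⟩ => ?_
  let Φ : UnitCube (n + 3) → F × ℝ :=
    fun z => H (Fin.tail z 0) (Fin.cons (z 0) (Fin.tail (Fin.tail z)))
  have hΦ : ∀ t r s, Φ (Fin.cons t (Fin.cons r s)) = H r (Fin.cons t s) := fun t r s => rfl
  have hΦc : Continuous Φ := by
    refine hHc.comp (Continuous.prodMk ?_ (continuous_cons_cube.comp (Continuous.prodMk ?_ ?_)))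
    · exact (continuous_apply 0).comp continuous_tail_cube
    · exact continuous_apply 0
    · exact continuous_tail_cube.comp continuous_tail_cube
  obtain ⟨δ, hδ, hδΦ⟩ := exists_norm_lower_bound Φ hΦc fun z => hHS _ _
  obtain ⟨η, hη, -, hηf⟩ := exists_close isOpen_ne hf isOpen_univ (mem_univ _)
  have hy₀ : 0 < ‖(y₀ : F)‖ := norm_pos_iff.2 y₀.2
  obtain ⟨ε, hε, hεδ, hεη, hεy⟩ : ∃ ε > 0, ε ≤ δ ∧ ε ≤ η ∧ 2 * ε ≤ ‖(y₀ : F)‖ :=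
    ⟨min δ (min η (‖(y₀ : F)‖ / 2)), by positivity, min_le_left _ _,
      (min_le_right _ _).trans (min_le_left _ _), by
        linarith [(min_le_right δ (min η (‖(y₀ : F)‖ / 2))).trans (min_le_right _ _)]⟩
  obtain ⟨G, hGc, hGΦ, hGx, hGp⟩ := exists_avoiding_pair
    (LinearMap.ker (LinearMap.fst ℝ F ℝ)) (LinearMap.ker (LinearMap.fst ℝ F ℝ))
    (by rw [finrank_snd_line, finrank_prod, finrank_self]; omega) Φ hΦc ((y₀ : F), (0 : ℝ)) hε
  have hfst : ∀ z, ‖(G z).1 - (Φ z).1‖ < ε := fun z => (norm_fst_le (G z - Φ z)).trans_lt (hGΦ z)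
  have hsnd : ∀ z, |(G z).2 - (Φ z).2| < ε := fun z => (norm_snd_le (G z - Φ z)).trans_lt (hGΦ z)
  have hnear : ∀ z, ‖Φ z - ((y₀ : F), (0 : ℝ))‖ < ε → (G z).1 ≠ 0 := fun z hz h0 => by
    have h1 := (norm_fst_le (Φ z - ((y₀ : F), (0 : ℝ)))).trans_lt hz
    have h2 := hfst z
    rw [h0, zero_sub, norm_neg] at h2
    have h3 := norm_sub_norm_le (y₀ : F) ((Φ z).1)
    rw [← norm_neg ((y₀ : F) - _), neg_sub] at h3
    simp only [Prod.fst_sub] at h1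
    linarith
  obtain ⟨τ, hτc, hτ, hτA, hτB⟩ := exists_separating G (A := {p | p.1 = 0 ∧ 0 ≤ p.2})
    (B := {p | p.1 = 0 ∧ p.2 ≤ 0})
    (((isClosed_eq continuous_fst continuous_const).inter
      (isClosed_le continuous_const continuous_snd)).preimage hGc)
    (((isClosed_eq continuous_fst continuous_const).inter
      (isClosed_le continuous_snd continuous_const)).preimage hGc) fun s t t' h1 h2 => by
      by_cases htt : t = t'
      · subst htt
        have h3 := hGΦ (Fin.cons t s)
        rw [show G (Fin.cons t s) = 0 from Prod.ext h1.1 (le_antisymm h2.2 h1.2), zero_sub,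
          norm_neg] at h3
        linarith [hδΦ (Fin.cons t s)]
      · rcases hGp s t t' htt h1.1 h2.1 with h | h
        · exact hnear _ h h1.1
        · exact hnear _ h h2.1
  have hGb : ∀ z, Φ z = ((y₀ : F), (0 : ℝ)) → (G z).1 = y₀ := fun z hz => by rw [hGx z hz]
  have hΦt : ∀ t r s, t = 0 ∨ t = 1 ∨ s ∈ Cube.boundary (Fin (n + 1)) →
      Φ (Fin.cons t (Fin.cons r s)) = ((y₀ : F), (0 : ℝ)) := fun t r s h =>
    (hΦ t r s).trans (hHb r _ (cons_mem_boundary.2 h))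
  let lam : UnitCube (n + 2) → I := fun s => clamp (1 - τ s)
  have hlam : Continuous lam := by fun_prop
  let K : I → UnitCube (n + 1) → F := fun r s =>
    (G (Fin.cons (lam (Fin.cons r s)) (Fin.cons r s))).1
  have hKc : Continuous (Function.uncurry K) := by
    refine continuous_fst.comp (hGc.comp (continuous_cons_cube.comp
      (Continuous.prodMk (hlam.comp ?_) ?_))) <;> exact continuous_cons_cube
  have hK0 : ∀ r s, K r s ≠ 0 := fun r s h0 => by
    rcases le_total 0 (G (Fin.cons (lam (Fin.cons r s)) (Fin.cons r s))).2 with h | h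
    · have h1 : lam (Fin.cons r s) = 0 := clamp_of_le (by rw [hτA _ _ ⟨h0, h⟩]; simp)
      exact y₀.2 ((hGb _ (hΦt _ r s (Or.inl h1))).symm.trans h0)
    · have h1 : lam (Fin.cons r s) = 1 := clamp_of_ge (by rw [hτB _ _ ⟨h0, h⟩]; simp)
      exact y₀.2 ((hGb _ (hΦt _ r s (Or.inr (Or.inl h1)))).symm.trans h0)
  have hKb : ∀ r, ∀ s ∈ Cube.boundary (Fin (n + 1)), K r s = y₀ := fun r s hs =>
    hGb _ (hΦt _ r s (Or.inr (Or.inr hs)))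
  have hK1 : K 1 = fun _ => (y₀ : F) := by
    ext s
    exact hGb _ ((hΦ _ _ _).trans (by rw [hH1]; rfl))
  let half : I := ⟨1 / 2, by norm_num, by norm_num⟩
  have hΦ0 : ∀ t s, Φ (Fin.cons t (Fin.cons 0 s)) = susp (y₀ : F) (f s) t := fun t s =>
    (hΦ t 0 s).trans (by rw [hH0]; rfl)
  obtain ⟨hk, hkf⟩ := hηf (fun s => (G (Fin.cons half (Fin.cons 0 s))).1)
    (continuous_fst.comp (hGc.comp (continuous_cons_cube.comp (continuous_const.prodMk
      (continuous_cons_cube.comp (continuous_const.prodMk continuous_id))))))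
    (fun s => by
      have h1 := hfst (Fin.cons half (Fin.cons 0 s))
      rw [hΦ0, susp_half] at h1
      exact h1.trans_le hεη)
    (fun s hs => hGb _ (by rw [hΦ0, susp_half, hs]))
  have hK0' : IsLoop (nz F) y₀ (K 0) :=
    ⟨hKc.comp (Continuous.prodMk_right (0 : I)), hK0 0, hKb 0⟩
  refine LoopHomotopic.trans hf hk isLoop_const ((cls_eq_iff hf hk).1 hkf.symm)
    (LoopHomotopic.trans hk hK0' isLoop_const ?_
    ⟨K, hKc, hK0, rfl, hK1, hKb⟩)
  have hlev : ∀ μ : I, ∀ a : I, (1 - (μ : ℝ)) / 2 + μ * a ∈ Icc (0 : ℝ) 1 := fun μ a =>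
    ⟨by nlinarith [μ.2.1, μ.2.2, a.2.1, a.2.2], by nlinarith [μ.2.1, μ.2.2, a.2.1, a.2.2]⟩
  refine ⟨fun μ s => (G (Fin.cons (clamp ((1 - (μ : ℝ)) / 2 + μ * lam (Fin.cons 0 s)))
    (Fin.cons 0 s))).1, ?_, fun μ s h0 => ?_, ?_, ?_,
    fun μ s hs => hGb _ (hΦt _ _ _ (Or.inr (Or.inr hs)))⟩
  · have h1 : Continuous fun p : I × UnitCube (n + 1) => (Fin.cons 0 p.2 : UnitCube (n + 2)) :=
      continuous_cons_cube.comp (continuous_const.prodMk continuous_snd)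
    have h2 := hlam.comp h1
    simp only [Function.comp_def] at h2
    refine continuous_fst.comp (hGc.comp (continuous_cons_cube.comp (Continuous.prodMk ?_ h1)))
    fun_prop
  · beta_reduce at h0
    set ℓ := clamp ((1 - (μ : ℝ)) / 2 + μ * lam (Fin.cons 0 s))
    have hℓv : (ℓ : ℝ) = (1 - (μ : ℝ)) / 2 + μ * lam (Fin.cons 0 s) := coe_clamp_of_mem (hlev _ _)
    have h1 := hfst (Fin.cons ℓ (Fin.cons 0 s))
    have h2 := hsnd (Fin.cons ℓ (Fin.cons 0 s))
    have h3 := hδΦ (Fin.cons ℓ (Fin.cons 0 s))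
    rw [h0, zero_sub, norm_neg] at h1
    have h4 : ε ≤ |(Φ (Fin.cons ℓ (Fin.cons 0 s))).2| := by
      rcases le_max_iff.1 (hεδ.trans h3) with h | h
      · linarith
      · exact h
    have h5 : (Φ (Fin.cons ℓ (Fin.cons 0 s))).2 =
        (1 - |2 * (ℓ : ℝ) - 1|) * (2 * ℓ - 1) * ‖f s - y₀‖ := by rw [hΦ0]; rfl
    have hm : 0 ≤ (1 - |2 * (ℓ : ℝ) - 1|) * ‖f s - y₀‖ := by
      refine mul_nonneg ?_ (norm_nonneg _)
      rw [sub_nonneg, abs_le]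
      constructor <;> linarith [ℓ.2.1, ℓ.2.2]
    rw [abs_lt] at h2
    rcases le_total 0 (G (Fin.cons ℓ (Fin.cons 0 s))).2 with h | h
    · have h6 : lam (Fin.cons 0 s) = 0 := clamp_of_le (by rw [hτA _ _ ⟨h0, h⟩]; simp)
      rw [h6, Icc.coe_zero, mul_zero] at hℓv
      have h7 : (Φ (Fin.cons ℓ (Fin.cons 0 s))).2 ≤ 0 := by
        rw [h5, mul_right_comm]
        exact mul_nonpos_of_nonneg_of_nonpos hm (by linarith [μ.2.1])
      rw [abs_of_nonpos h7] at h4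
      linarith
    · have h6 : lam (Fin.cons 0 s) = 1 := clamp_of_ge (by rw [hτB _ _ ⟨h0, h⟩]; simp)
      rw [h6, Icc.coe_one, mul_one] at hℓv
      have h7 : 0 ≤ (Φ (Fin.cons ℓ (Fin.cons 0 s))).2 := by
        rw [h5, mul_right_comm]
        exact mul_nonneg hm (by linarith [μ.2.1])
      rw [abs_of_nonneg h7] at h4
      linarith
  · ext s
    have : clamp ((1 - ((0 : I) : ℝ)) / 2 + (0 : I) * lam (Fin.cons 0 s)) = half := by
      simp only [Icc.coe_zero, sub_zero, zero_mul, add_zero]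
      exact clamp_coe half
    simp only [this]
  · ext s
    have : clamp ((1 - ((1 : I) : ℝ)) / 2 + (1 : I) * lam (Fin.cons 0 s)) = lam (Fin.cons 0 s) := by
      simp
    simp only [this, K]

end SuspensionInjective

section PlaneSuspension

open ComplexConjugate

/-- The base point `1` of the punctured plane. -/
def planeBase : nz ℂ := ⟨1, one_ne_zero⟩

theorem suspHom_plane_injective : Function.Injective (suspHom planeBase 0) := by
  refine suspHom_injective_of _ _ fun f hf ⟨H, hHc, hHS, hH0, hH1, hHb⟩ => ?_
  obtain ⟨L, hLc, hL, hL0, hLb⟩ := exists_lift_hopf (fun (z : UnitCube 2) r => H (σ r) z)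
    (hHc.comp ((continuous_symm.comp continuous_snd).prodMk continuous_fst))
    (fun z r => hHS _ _) (fun _ => (hopfBase : ℂ × ℂ)) continuous_const
    (fun z => by rw [hopf_hopfBase, unitInterval.symm_zero, hH1]; rfl)
  let ℓ : UnitCube 2 → ℂ × ℂ := fun z => L z 1
  have hℓc : Continuous ℓ := hLc.comp (Continuous.prodMk_left 1)
  have hℓ : ∀ t s, hopf (ℓ (Fin.cons t s)) = susp 1 (f s) t := fun t s => by
    simp only [ℓ, hL, unitInterval.symm_one, hH0]
    rfl
  have hℓb : ∀ z ∈ Cube.boundary (Fin 2), ℓ z = hopfBase := fun z hz =>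
    hLb z (fun t => by rw [hHb _ z hz, hHb _ z hz]) 1
  have hbase : 2 * (hopfBase : ℂ × ℂ).1 * conj (hopfBase : ℂ × ℂ).2 = 1 :=
    congrArg Prod.fst hopf_hopfBase
  have hne : ∀ t s, ℓ (Fin.cons t s) ≠ 0 := fun t s h0 => by
    have := hℓ t s
    rw [h0, hopf_zero] at this
    exact susp_ne_zero one_ne_zero (hf.mem s) _ this.symm
  have hm : ∀ (t : I) s, 0 ≤ (1 - |2 * (t : ℝ) - 1|) * ‖f s - 1‖ := fun t s => by
    refine mul_nonneg ?_ (norm_nonneg _)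
    rw [sub_nonneg, abs_le]
    constructor <;> linarith [t.2.1, t.2.2]
  have hsnd : ∀ (t : I) s, Complex.normSq (ℓ (Fin.cons t s)).1 -
      Complex.normSq (ℓ (Fin.cons t s)).2 = (1 - |2 * (t : ℝ) - 1|) * ‖f s - 1‖ * (2 * t - 1) :=
    fun t s => (congrArg Prod.snd (hℓ t s)).trans (mul_right_comm _ _ _)
  have h1 : ∀ (t : I) s, 1 / 2 ≤ (t : ℝ) → (ℓ (Fin.cons t s)).1 ≠ 0 := fun t s ht h0 => by
    have h := hsnd t s
    have h2 := mul_nonneg (hm t s) (show 0 ≤ 2 * (t : ℝ) - 1 by linarith)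
    rw [← h, h0, map_zero, zero_sub, neg_nonneg] at h2
    exact hne t s (Prod.ext h0 (Complex.normSq_eq_zero.1
      (le_antisymm h2 (Complex.normSq_nonneg _))))
  have h2 : ∀ (t : I) s, (t : ℝ) ≤ 1 / 2 → (ℓ (Fin.cons t s)).2 ≠ 0 := fun t s ht h0 => by
    have h := hsnd t s
    have h2 := mul_nonpos_of_nonneg_of_nonpos (hm t s) (show 2 * (t : ℝ) - 1 ≤ 0 by linarith)
    rw [← h, h0, map_zero, sub_zero] at h2
    exact hne t s (Prod.ext (Complex.normSq_eq_zero.1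
      (le_antisymm h2 (Complex.normSq_nonneg _))) h0)
  let hi : I → I := fun r => ⟨(1 + r) / 2, by linarith [r.2.1], by linarith [r.2.2]⟩
  let lo : I → I := fun r => ⟨(1 - r) / 2, by linarith [r.2.2], by linarith [r.2.1]⟩
  refine ⟨fun r s => 2 * (ℓ (Fin.cons (hi r) s)).1 * conj (ℓ (Fin.cons (lo r) s)).2, ?_,
    fun r s => ?_, ?_, ?_, fun r s hs => ?_⟩
  · have hhi : Continuous hi := Continuous.subtype_mk (by fun_prop) _
    have hlo : Continuous lo := Continuous.subtype_mk (by fun_prop) _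
    have e1 := hℓc.comp (continuous_cons_cube.comp
      ((hhi.comp continuous_fst).prodMk (continuous_snd (X := I) (Y := UnitCube 1))))
    have e2 := hℓc.comp (continuous_cons_cube.comp
      ((hlo.comp continuous_fst).prodMk (continuous_snd (X := I) (Y := UnitCube 1))))
    exact (continuous_const.mul e1.fst).mul (Complex.continuous_conj.comp e2.snd)
  · have h3 := h1 (hi r) s (by change _ ≤ (1 + (r : ℝ)) / 2; linarith [r.2.1])
    have h4 := h2 (lo r) s (by change (1 - (r : ℝ)) / 2 ≤ _; linarith [r.2.1])
    simpa using ⟨h3, h4⟩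
  · ext1 s
    have h3 : hi 0 = lo 0 := Subtype.ext (by simp [hi, lo])
    have h4 : ((lo 0 : I) : ℝ) = 1 / 2 := by simp [lo]
    have h5 := congrArg Prod.fst (hℓ (lo 0) s)
    rw [h4, susp_half] at h5
    simp only [h3]
    exact h5
  · ext1 s
    have h3 : hi 1 = 1 := Subtype.ext (by simp [hi])
    have h4 : lo 1 = 0 := Subtype.ext (by simp [lo])
    simp only [h3, h4, hℓb _ (cons_mem_boundary.2 (Or.inl rfl)),
      hℓb _ (cons_mem_boundary.2 (Or.inr (Or.inl rfl)))]
    exact hbase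
  · simp only [hℓb _ (cons_mem_boundary.2 (Or.inr (Or.inr hs)))]
    exact hbase

end PlaneSuspension

section LowGroups

theorem exists_piThree_four (x : nz (ℂ × ℂ)) :
    Nonempty (HomotopyGroup (Fin 3) (nz (ℂ × ℂ)) x ≃* Multiplicative ℤ) := by
  obtain ⟨e⟩ := exists_piOne_equiv
  have h1 : Function.Bijective (suspHom planeBase 0) := ⟨suspHom_plane_injective,
    suspHom_surjective _ (by simp [Complex.finrank_real_complex])⟩
  have h2 : Function.Bijective (suspHom (suspBase planeBase) 1) :=
    ⟨suspHom_injective _ (by simp [Complex.finrank_real_complex]),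
      suspHom_surjective _ (by simp [Complex.finrank_real_complex])⟩
  obtain ⟨e'⟩ := exists_equiv_nz (V := ℂ × ℂ) (V' := (ℂ × ℝ) × ℝ)
    (by simp [Complex.finrank_real_complex]) x (suspBase (suspBase planeBase)) 2
  exact ⟨(e'.trans (MulEquiv.ofBijective _ h2).symm).trans
    ((MulEquiv.ofBijective _ h1).symm.trans e)⟩

theorem exists_piThree_three (x : nz (ℂ × ℝ)) :
    Nonempty (HomotopyGroup (Fin 3) (nz (ℂ × ℝ)) x ≃* Multiplicative ℤ) := by
  obtain ⟨e⟩ := exists_piThree_four hopfBase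
  obtain ⟨e'⟩ := exists_equiv_nz (V := ℂ × ℝ) (V' := ℂ × ℝ) rfl x
    ⟨(1, 0), by simp⟩ 2
  exact ⟨(e'.trans (MulEquiv.ofBijective _ (mapHom_hopf_bijective 0)).symm).trans e⟩

end LowGroups

section Equivalence

variable {V V' : Type*} [TopologicalSpace V] [TopologicalSpace V'] {n : ℕ}
  {S' : Set V'} {x' : S'} {S : Set V} {x : S}

theorem exists_equiv_of_deform {φ : V → V'} {ψ : V' → V} (hφ : BasedMap S x S' x' φ)
    (hψ : BasedMap S' x' S x ψ) (h : ∀ y ∈ S, ψ (φ y) = y) (D : I → V' → V')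
    (hc : ContinuousOn (Function.uncurry D) (univ ×ˢ S')) (hS : ∀ r, ∀ y ∈ S', D r y ∈ S')
    (hx : ∀ r, D r x' = x') (h0 : ∀ y ∈ S', D 0 y = y) (h1 : ∀ y ∈ S', D 1 y = φ (ψ y)) :
    Nonempty (HomotopyGroup (Fin (n + 1)) S x ≃* HomotopyGroup (Fin (n + 1)) S' x') := by
  refine ⟨MulEquiv.mk ⟨mapHom hφ n, mapHom hψ n, mapHom_mapHom hφ hψ h, fun a => ?_⟩
    (map_mul (mapHom hφ n))⟩
  obtain ⟨f, hf, rfl⟩ := exists_loop a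
  rw [mapHom_cls, mapHom_cls]
  exact (cls_eq_of_deform hf _ D S' hf.mem hc hS hx (fun z => h0 _ (hf.mem z))
    fun z => h1 _ (hf.mem z)).symm

end Equivalence

section Model

/-- The coordinates `(u, v, w)` on Euclidean space of dimension 7. -/
abbrev Triple := E 3 × ℂ × ℂ

/-- The difference of squared norms whose zero set, with `w = 0`, is removed. -/
def quad (p : Triple) : ℝ := ‖p.1‖ ^ 2 - ‖p.2.1‖ ^ 2

@[fun_prop]
theorem continuous_quad : Continuous quad := by
  unfold quad
  fun_prop

/-- The complement of the cone `‖u‖ = ‖v‖`, `w = 0`. -/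
def coneCompl : Set Triple := {p | p.2.2 ≠ 0 ∨ quad p ≠ 0}

/-- The first standard basis vector. -/
def e₁ : E 3 := EuclideanSpace.single 0 1

@[simp] theorem norm_e₁ : ‖e₁‖ = 1 := by simp [e₁]

/-- The base point `(e₁, 0, 1)`. -/
def coneBase : coneCompl := ⟨(e₁, 0, 1), Or.inl one_ne_zero⟩

theorem isOpen_coneCompl : IsOpen coneCompl :=
  (isOpen_ne_fun (by fun_prop) continuous_const).union
    (isOpen_ne_fun (by fun_prop) continuous_const)

/-- The point of `E 7` with coordinates `(u, v, w)`. -/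
def ofTriple (p : Triple) : E 7 :=
  !₂[p.1 0, p.1 1, p.1 2, p.2.1.re, p.2.1.im, p.2.2.re, p.2.2.im]

/-- The coordinates `(u, v, w)` of a point of `E 7`. -/
def toTriple (x : E 7) : Triple := (!₂[x 0, x 1, x 2], ⟨x 3, x 4⟩, ⟨x 5, x 6⟩)

theorem ofTriple_toTriple (x : E 7) : ofTriple (toTriple x) = x := by
  ext i
  fin_cases i <;> rfl

theorem toTriple_ofTriple (p : Triple) : toTriple (ofTriple p) = p := by
  refine Prod.ext ?_ (Prod.ext rfl rfl)
  ext i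
  fin_cases i <;> rfl

@[fun_prop]
theorem continuous_toTriple : Continuous toTriple := by
  unfold toTriple
  refine Continuous.prodMk (by fun_prop) (Continuous.prodMk ?_ ?_)
  · exact Complex.equivRealProdCLM.symm.continuous.comp
      (f := fun x : E 7 => (x 3, x 4)) (by fun_prop)
  · exact Complex.equivRealProdCLM.symm.continuous.comp
      (f := fun x : E 7 => (x 5, x 6)) (by fun_prop)

@[fun_prop]
theorem continuous_ofTriple : Continuous ofTriple := by
  unfold ofTriple
  refine (PiLp.continuous_toLp 2 _).comp (continuous_pi fun i => ?_)
  fin_cases i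
  · change Continuous fun p : Triple => p.1 0; fun_prop
  · change Continuous fun p : Triple => p.1 1; fun_prop
  · change Continuous fun p : Triple => p.1 2; fun_prop
  · change Continuous fun p : Triple => p.2.1.re; fun_prop
  · change Continuous fun p : Triple => p.2.1.im; fun_prop
  · change Continuous fun p : Triple => p.2.2.re; fun_prop
  · change Continuous fun p : Triple => p.2.2.im; fun_prop

theorem toTriple_smul (c : ℝ) (x : E 7) : toTriple (c • x) = c • toTriple x := by
  refine Prod.ext ?_ (Prod.ext ?_ ?_)
  · ext i
    fin_cases i <;> rfl
  · apply Complex.ext <;> simp [toTriple]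
  · apply Complex.ext <;> simp [toTriple]

theorem norm_sq_toTriple (x : E 7) :
    ‖x‖ ^ 2 = ‖(toTriple x).1‖ ^ 2 + ‖(toTriple x).2.1‖ ^ 2 + ‖(toTriple x).2.2‖ ^ 2 := by
  rw [← Complex.normSq_eq_norm_sq, ← Complex.normSq_eq_norm_sq, EuclideanSpace.norm_sq_eq,
    EuclideanSpace.norm_sq_eq]
  simp only [Fin.sum_univ_succ, Real.norm_eq_abs, sq_abs, Complex.normSq_apply, toTriple]
  simp [Fin.succ]
  ring

theorem mem_T_iff {x : E 7} (hx : ‖x‖ = 1) :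
    x ∈ T ↔ (toTriple x).2.2 = 0 ∧ quad (toTriple x) = 0 := by
  have h := norm_sq_toTriple x
  have hu : ‖(toTriple x).1‖ ^ 2 = x 0 ^ 2 + x 1 ^ 2 + x 2 ^ 2 := by
    rw [EuclideanSpace.norm_sq_eq]
    simp [Fin.sum_univ_succ, toTriple, add_assoc]
  have hv : ‖(toTriple x).2.1‖ ^ 2 = x 3 ^ 2 + x 4 ^ 2 := by
    rw [← Complex.normSq_eq_norm_sq, Complex.normSq_apply]
    simp only [toTriple]
    ring
  simp only [T, mem_ofPred_eq, mem_sphere_zero_iff_norm, hx, true_and, quad, ← hu, ← hv]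
  rw [hx] at h
  constructor
  · rintro ⟨h1, h2⟩
    refine ⟨norm_eq_zero.1 (pow_eq_zero_iff two_ne_zero |>.1 ?_), ?_⟩ <;> linarith
  · rintro ⟨h1, h2⟩
    rw [h1, norm_zero] at h
    constructor <;> linarith

/-- The shear `w ↦ w + a q₊`. -/
def shear (a : ℝ) (p : Triple) : Triple := (p.1, p.2.1, p.2.2 + (a * max (quad p) 0 : ℝ))

@[fun_prop]
theorem continuous_shear (a : ℝ) : Continuous (shear a) := by
  unfold shear
  fun_prop

theorem shear_shear (a : ℝ) (p : Triple) : shear (-a) (shear a p) = p := by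
  have : quad (shear a p) = quad p := rfl
  refine Prod.ext rfl (Prod.ext rfl ?_)
  change p.2.2 + _ + ((-a * max (quad (shear a p)) 0 : ℝ) : ℂ) = p.2.2
  rw [this]
  push_cast
  ring

theorem quad_smul (c : ℝ) (p : Triple) : quad (c • p) = c ^ 2 * quad p := by
  simp only [quad, Prod.smul_fst, Prod.smul_snd, norm_smul, mul_pow, Real.norm_eq_abs, sq_abs]
  ring

theorem quad_shear (a : ℝ) (p : Triple) : quad (shear a p) = quad p := rfl

theorem shear_mem_iff {a : ℝ} {p : Triple} : shear a p ∈ coneCompl ↔ p ∈ coneCompl := by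
  by_cases h : quad p = 0
  · simp [coneCompl, h, shear]
  · simp [coneCompl, quad_shear, h]

theorem smul_mem_coneCompl {c : ℝ} (hc : 0 < c) {p : Triple} :
    c • p ∈ coneCompl ↔ p ∈ coneCompl := by
  simp [coneCompl, quad_smul, hc.ne']

theorem mem_compl_T_iff {x : E 7} (hx : ‖x‖ = 1) : x ∉ T ↔ toTriple x ∈ coneCompl := by
  rw [mem_T_iff hx, coneCompl, mem_ofPred_eq]
  tauto

theorem zero_notMem_coneCompl : (0 : Triple) ∉ coneCompl := by simp [coneCompl, quad]

theorem ofTriple_ne_zero {p : Triple} (hp : p ∈ coneCompl) : ofTriple p ≠ 0 := by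
  intro h
  apply zero_notMem_coneCompl
  convert hp
  rw [← toTriple_ofTriple p, h]
  simpa using (toTriple_smul 0 0).symm

theorem exists_equiv_coneCompl (n : ℕ) : Nonempty (
    HomotopyGroup (Fin (n + 1)) (Metric.sphere (0 : E 7) 1 \ T : Set (E 7)) basePoint ≃*
      HomotopyGroup (Fin (n + 1)) coneCompl coneBase) := by
  have hbase : toTriple (basePoint : E 7) = (e₁, 0, 0) := by
    refine Prod.ext ?_ (Prod.ext ?_ ?_)
    · ext i
      fin_cases i <;> simp [toTriple, basePoint, e₁]
    · apply Complex.ext <;> simp [toTriple, basePoint]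
    · apply Complex.ext <;> simp [toTriple, basePoint]
  have hsb : shear 1 (e₁, 0, 0) = (e₁, 0, 1) := by simp [shear, quad]
  have hsb' : shear (-1) (e₁, 0, 1) = (e₁, 0, 0) := by simp [shear, quad]
  have hof : ofTriple (e₁, 0, 0) = basePoint := by rw [← hbase, ofTriple_toTriple]
  have hnb : ‖(basePoint : E 7)‖ = 1 := by simpa using basePoint.2.1
  have hnz : ∀ p ∈ coneCompl, ofTriple (shear (-1) p) ≠ 0 := fun p hp =>
    ofTriple_ne_zero (shear_mem_iff.2 hp)
  let N : Triple → ℝ := fun p => ‖ofTriple (shear (-1) p)‖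
  have hN : ∀ p ∈ coneCompl, 0 < N p := fun p hp => norm_pos_iff.2 (hnz p hp)
  have hNc : Continuous N := by fun_prop
  have hNb : N coneBase = 1 := by
    change ‖ofTriple (shear (-1) (e₁, 0, 1))‖ = 1
    rw [hsb', hof, hnb]
  let c : I → Triple → ℝ := fun r p => (1 - r) + r * (N p)⁻¹
  have hc : ∀ r, ∀ p ∈ coneCompl, 0 < c r p := by
    intro r p hp
    have h1 := inv_pos.2 (hN p hp)
    rcases r.2.2.lt_or_eq with h | h
    · have := mul_nonneg r.2.1 h1.le
      simp only [c]
      linarith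
    · simp only [c, h]
      linarith
  refine exists_equiv_of_deform (φ := fun x => shear 1 (toTriple x))
    (ψ := fun p => (N p)⁻¹ • ofTriple (shear (-1) p)) ⟨?_, ?_, ?_⟩ ⟨?_, ?_, ?_⟩ ?_
    (fun r p => shear 1 (c r p • shear (-1) p)) ?_ ?_ ?_ ?_ ?_
  · fun_prop
  · rintro x ⟨hx, hxT⟩
    exact shear_mem_iff.2 ((mem_compl_T_iff (by simpa using hx)).1 hxT)
  · change shear 1 (toTriple (basePoint : E 7)) = (e₁, 0, 1)
    rw [hbase, hsb]
  · exact (hNc.continuousOn.inv₀ fun p hp => (hN p hp).ne').smul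
      (continuous_ofTriple.comp (continuous_shear (-1))).continuousOn
  · intro p hp
    have h1 : ‖(N p)⁻¹ • ofTriple (shear (-1) p)‖ = 1 := by
      rw [norm_smul, norm_inv, Real.norm_of_nonneg (hN p hp).le]
      exact inv_mul_cancel₀ (hN p hp).ne'
    refine ⟨by simpa using h1, (mem_compl_T_iff h1).2 ?_⟩
    rw [toTriple_smul, toTriple_ofTriple, smul_mem_coneCompl (inv_pos.2 (hN p hp)), shear_mem_iff]
    exact hp
  · rw [hNb]
    change (1 : ℝ)⁻¹ • ofTriple (shear (-1) (e₁, 0, 1)) = _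
    rw [hsb', hof, inv_one, one_smul]
  · rintro x ⟨hx, -⟩
    have h1 : ofTriple (shear (-1) (shear 1 (toTriple x))) = x := by
      rw [shear_shear, ofTriple_toTriple]
    simp only [N, h1]
    rw [show ‖x‖ = 1 by simpa using hx, inv_one, one_smul]
  · have hcc : ContinuousOn (fun a : I × Triple => c a.1 a.2) (univ ×ˢ coneCompl) := by
      refine ContinuousOn.add (by fun_prop) (ContinuousOn.mul (by fun_prop) ?_)
      exact (hNc.comp continuous_snd).continuousOn.inv₀ fun p hp => (hN p.2 hp.2).ne'
    exact (continuous_shear 1).comp_continuousOn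
      (f := fun a : I × Triple => c a.1 a.2 • shear (-1) a.2)
      (hcc.smul (Continuous.continuousOn (by fun_prop)))
  · intro r p hp
    rw [shear_mem_iff, smul_mem_coneCompl (hc r p hp), shear_mem_iff]
    exact hp
  · intro r
    have : c r coneBase = 1 := by simp [c, hNb]
    rw [this, one_smul]
    simpa using shear_shear (-1) (coneBase : Triple)
  · intro p hp
    have : c 0 p = 1 := by simp [c]
    rw [this, one_smul]
    simpa using shear_shear (-1) p
  · intro p hp
    have : c 1 p = (N p)⁻¹ := by simp [c]
    rw [this, toTriple_smul, toTriple_ofTriple]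

end Model

section Decomposition

variable {V : Type*} [TopologicalSpace V] {n : ℕ} {S : Set V} {x : S}

/-- The loop following `f` up to the middle slice and then the null-homotopy `K` of that slice. -/
def lowerPart (f : UnitCube (n + 1) → V) (K : I → UnitCube n → V) (z : UnitCube (n + 1)) : V :=
  if (z 0 : ℝ) ≤ 1 / 2 then f z else K (clamp (2 * z 0 - 1)) (Fin.tail z)

/-- The loop following the null-homotopy `K` of the middle slice backwards and then `f`. -/
def upperPart (f : UnitCube (n + 1) → V) (K : I → UnitCube n → V) (z : UnitCube (n + 1)) : V :=
  if (z 0 : ℝ) ≤ 1 / 2 then K (clamp (1 - 2 * z 0)) (Fin.tail z) else f z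

variable {f : UnitCube (n + 1) → V} {K : I → UnitCube n → V} {half : I}

omit [TopologicalSpace V] in
theorem eq_cons_half (hhalf : (half : ℝ) = 1 / 2) {z : UnitCube (n + 1)} (hz : (z 0 : ℝ) = 1 / 2) :
    f z = f (Fin.cons half (Fin.tail z)) := by
  rw [show half = z 0 from Subtype.ext (hhalf.trans hz.symm), Fin.cons_self_tail]

theorem isLoop_lowerPart {P : Set V} {x' : P} (hf : IsLoop S x f) (hx : (x' : V) = x)
    (hhalf : (half : ℝ) = 1 / 2)
    (hKc : Continuous (Function.uncurry K)) (hK0 : K 0 = fun s => f (Fin.cons half s))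
    (hK1 : K 1 = fun _ => (x : V)) (hKb : ∀ r, ∀ s ∈ Cube.boundary (Fin n), K r s = x)
    (hfP : ∀ z, (z 0 : ℝ) ≤ 1 / 2 → f z ∈ P) (hKP : ∀ r s, K r s ∈ P) :
    IsLoop P x' (lowerPart f K) := by
  refine ⟨?_, fun z => ?_, fun z hz => ?_⟩
  · refine Continuous.if_le hf.cont (hKc.comp (Continuous.prodMk ?_ continuous_tail_cube))
      (by fun_prop) continuous_const fun z hz => ?_
    · fun_prop
    · rw [clamp_of_le (by linarith), hK0]
      exact eq_cons_half hhalf hz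
  · unfold lowerPart
    split_ifs with h
    exacts [hfP z h, hKP _ _]
  · unfold lowerPart
    split_ifs with h
    · rw [hf.bdry z hz, hx]
    · rcases mem_boundary_succ.1 hz with h0 | h0 | h0
      · simp [h0] at h
      · rw [h0, clamp_of_ge (by norm_num), hK1, hx]
      · rw [hKb _ _ h0, hx]

theorem isLoop_upperPart {P : Set V} {x' : P} (hf : IsLoop S x f) (hx : (x' : V) = x)
    (hhalf : (half : ℝ) = 1 / 2)
    (hKc : Continuous (Function.uncurry K)) (hK0 : K 0 = fun s => f (Fin.cons half s))
    (hK1 : K 1 = fun _ => (x : V)) (hKb : ∀ r, ∀ s ∈ Cube.boundary (Fin n), K r s = x)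
    (hfP : ∀ z, 1 / 2 ≤ (z 0 : ℝ) → f z ∈ P) (hKP : ∀ r s, K r s ∈ P) :
    IsLoop P x' (upperPart f K) := by
  refine ⟨?_, fun z => ?_, fun z hz => ?_⟩
  · refine Continuous.if_le (hKc.comp (Continuous.prodMk ?_ continuous_tail_cube)) hf.cont
      (by fun_prop) continuous_const fun z hz => ?_
    · fun_prop
    · rw [clamp_of_le (by linarith), hK0]
      exact (eq_cons_half hhalf hz).symm
  · unfold upperPart
    split_ifs with h
    exacts [hKP _ _, hfP z (not_le.1 h).le]
  · unfold upperPart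
    split_ifs with h
    · rcases mem_boundary_succ.1 hz with h0 | h0 | h0
      · rw [h0, clamp_of_ge (by norm_num), hK1, hx]
      · norm_num [h0] at h
      · rw [hKb _ _ h0, hx]
    · rw [hf.bdry z hz, hx]

theorem cls_eq_mul_parts {f : UnitCube (n + 1) → V} (hf : IsLoop S x f)
    (hhalf : (half : ℝ) = 1 / 2)
    (hKc : Continuous (Function.uncurry K)) (hKS : ∀ r s, K r s ∈ S)
    (hK0 : K 0 = fun s => f (Fin.cons half s))
    (hKb : ∀ r, ∀ s ∈ Cube.boundary (Fin n), K r s = x)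
    (hl : IsLoop S x (lowerPart f K)) (hu : IsLoop S x (upperPart f K)) :
    hf.cls = hu.cls * hl.cls := by
  have hfc := hf.cont
  let ζ : ℝ → ℝ := fun t => min (2 * t) (1 / 2) + max (2 * t - 3 / 2) 0
  have hζ : Continuous ζ := by fun_prop
  have hζ0 : ζ 0 = 0 := by norm_num [ζ]
  have hζ1 : ζ 1 = 1 := by norm_num [ζ]
  let H : I → UnitCube (n + 1) → V := fun r z =>
    f (Fin.cons (clamp ((1 - r) * z 0 + r * ζ (z 0))) (Fin.tail z))
  have hHc : Continuous (Function.uncurry H) := by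
    refine hf.cont.comp (continuous_cons_cube.comp (Continuous.prodMk ?_
      (continuous_tail_cube.comp continuous_snd)))
    fun_prop
  have hHb : ∀ r, ∀ z ∈ Cube.boundary (Fin (n + 1)), H r z = x := fun r z hz => by
    refine hf.bdry _ (cons_mem_boundary.2 ?_)
    rcases mem_boundary_succ.1 hz with h | h | h
    · exact Or.inl (by simp [h, hζ0])
    · exact Or.inr (Or.inl (by simp [h, hζ1]))
    · exact Or.inr (Or.inr h)
  have hH0 : H 0 = f := by
    ext z
    simp [H, Fin.cons_self_tail]
  have hH1 : IsLoop S x (H 1) :=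
    ⟨hHc.comp (Continuous.prodMk_right (1 : I)), fun z => hf.mem _, hHb 1⟩
  have hH1v : ∀ z, H 1 z = f (Fin.cons (clamp (ζ (z 0))) (Fin.tail z)) := fun z => by simp [H]
  have hH1h : ∀ z : UnitCube (n + 1), |4 * (z 0 : ℝ) - 2| ≤ 1 →
      H 1 z = K 0 (Fin.tail z) := fun z hz => by
    rw [abs_le] at hz
    have : ζ (z 0) = 1 / 2 := by
      simp only [ζ]
      rw [min_eq_right (by linarith), max_eq_right (by linarith), add_zero]
    rw [hH1v, hK0, this, ← hhalf, clamp_coe]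
  let G : I → UnitCube (n + 1) → V := fun r z => if |4 * (z 0 : ℝ) - 2| ≤ 1 then
    K (clamp (r * (1 - |4 * (z 0 : ℝ) - 2|))) (Fin.tail z) else H 1 z
  have hup : ∀ (z : UnitCube (n + 1)) (a : I), Function.update z 0 a = Fin.cons a (Fin.tail z) :=
    fun z a => by
      conv_lhs => rw [← Fin.cons_self_tail z]
      exact Fin.update_cons_zero _ _ _
  rw [(cls_eq_iff hf hH1).2 ⟨H, hHc, fun r z => hf.mem _, hH0, rfl, hHb⟩, cls_mul 0 hu hl]
  refine (cls_eq_iff _ _).2 ⟨G, ?_, fun r z => ?_, ?_, ?_, fun r z hz => ?_⟩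
  · refine Continuous.if_le (hKc.comp (Continuous.prodMk ?_
      (continuous_tail_cube.comp continuous_snd))) (hH1.cont.comp continuous_snd)
      (by fun_prop) continuous_const fun p hp => ?_
    · fun_prop
    · change K (clamp (p.1 * (1 - |4 * (p.2 0 : ℝ) - 2|))) (Fin.tail p.2) = H 1 p.2
      rw [hH1h p.2 hp.le, hp, sub_self, mul_zero, clamp_zero]
  · simp only [G]
    split_ifs
    exacts [hKS _ _, hf.mem _]
  · ext z
    simp only [G]
    split_ifs with h
    · rw [hH1h z h, Icc.coe_zero, zero_mul, clamp_zero]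
    · rfl
  · ext z
    have hz0 := (z 0).2.1
    have hz1 := (z 0).2.2
    simp only [G, concat, lowerPart, upperPart, hup, Fin.cons_zero, Fin.tail_cons, hH1v,
      Icc.coe_one, one_mul]
    by_cases h : (z 0 : ℝ) ≤ 1 / 2
    · have h1 : ((clamp (2 * z 0) : I) : ℝ) = 2 * z 0 :=
        coe_clamp_of_mem ⟨by linarith, by linarith⟩
      have h2 : |4 * (z 0 : ℝ) - 2| = 2 - 4 * z 0 := by
        rw [abs_of_nonpos (by linarith)]; ring
      rw [if_pos h, h1, h2]
      rcases lt_trichotomy (z 0 : ℝ) (1 / 4) with h3 | h3 | h3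
      · rw [if_neg (by linarith), if_pos (by linarith)]
        simp only [ζ]
        rw [min_eq_left (by linarith), max_eq_right (by linarith), add_zero]
      · rw [if_pos (by linarith), if_pos (by linarith), clamp_of_le (by linarith), hK0, h3,
          show (2 * (1 / 4) : ℝ) = half by rw [hhalf]; norm_num, clamp_coe]
      · rw [if_pos (by linarith), if_neg (by linarith)]
        congr 2
        ring
    · rw [not_le] at h
      have h1 : ((clamp (2 * z 0 - 1) : I) : ℝ) = 2 * z 0 - 1 :=
        coe_clamp_of_mem ⟨by linarith, by linarith⟩
      have h2 : |4 * (z 0 : ℝ) - 2| = 4 * z 0 - 2 := abs_of_nonneg (by linarith)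
      rw [if_neg (not_le.2 h), h1, h2]
      rcases le_or_gt (z 0 : ℝ) (3 / 4) with h3 | h3
      · rw [if_pos (by linarith), if_pos (by linarith)]
        congr 2
        ring
      · rw [if_neg (by linarith), if_neg (by linarith)]
        simp only [ζ]
        rw [min_eq_right (by linarith), max_eq_left (by linarith)]
        congr 3
        ring
  · simp only [G]
    split_ifs with h
    · rcases mem_boundary_succ.1 hz with h0 | h0 | h0
      · norm_num [h0] at h
      · norm_num [h0] at h
      · exact hKb _ _ h0
    · exact hHb 1 z hz

end Decomposition

section Slit

/-- The plane minus the closed nonnegative real half-line. -/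
def Slit (z : ℂ) : Prop := z.im ≠ 0 ∨ z.re < 0

theorem Slit.ne_zero {z : ℂ} (h : Slit z) : z ≠ 0 := by
  rintro rfl
  simp [Slit] at h

theorem Slit.segment {z : ℂ} (h : Slit z) {a b : ℝ} (ha : 0 ≤ a) (hb : 0 ≤ b) (hab : 0 < a + b) :
    Slit (a • z - (b : ℂ)) := by
  have h1 : (a • z - (b : ℂ)).im = a * z.im := by simp
  have h2 : (a • z - (b : ℂ)).re = a * z.re - b := by simp
  rw [Slit, h1, h2]
  rcases ha.eq_or_lt with rfl | ha
  · exact Or.inr (by linarith)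
  · rcases h with h | h
    · exact Or.inl (mul_ne_zero ha.ne' h)
    · exact Or.inr (by nlinarith)

theorem Slit.smul {z : ℂ} (h : Slit z) {a : ℝ} (ha : 0 < a) : Slit (a • z) := by
  simpa using h.segment ha.le le_rfl (by linarith)

theorem slit_of_norm_lt {z : ℂ} {r : ℝ} (hr : r < ‖z‖) (h : ¬ (z.im = 0 ∧ r < z.re)) : Slit z := by
  by_cases him : z.im = 0
  · refine Or.inr (not_le.1 fun hre => h ⟨him, ?_⟩)
    rwa [← Complex.re_eq_norm.2 (Complex.nonneg_iff.2 ⟨hre, him.symm⟩)] at hr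
  · exact Or.inl him

end Slit

section Maps

/-- The map recording `w` and the quadratic form. -/
def toThree (p : Triple) : ℂ × ℝ := (p.2.2, quad p)

/-- A section up to homotopy of `toThree`. -/
def ofThree (p : ℂ × ℝ) : Triple := (max p.2 0 • e₁, ((-max (-p.2) 0 : ℝ) : ℂ), p.1)

/-- The embedding of the linking 3-sphere. -/
def ofFour (p : ℂ × ℂ) : Triple := (‖p.2‖ • e₁, p.1, p.2)

/-- A left inverse up to homotopy of `ofFour`. -/
def toFour (p : Triple) : ℂ × ℂ :=
  (((p.2.2.re - max (quad p) 0 : ℝ) : ℂ) + p.2.1.im * Complex.I,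
    ((‖p.1‖ - p.2.1.re : ℝ) : ℂ) + p.2.2.im * Complex.I)

/-- The base point `(1, 1)`. -/
def threeBase : nz (ℂ × ℝ) := ⟨(1, 1), by simp⟩

/-- The base point `(0, 1)`. -/
def fourBase : nz (ℂ × ℂ) := ⟨(0, 1), by simp⟩

theorem quad_ofThree (p : ℂ × ℝ) : quad (ofThree p) = max p.2 0 ^ 2 - max (-p.2) 0 ^ 2 := by
  simp [quad, ofThree, norm_smul]

theorem quad_ofFour (p : ℂ × ℂ) : quad (ofFour p) = ‖p.2‖ ^ 2 - ‖p.1‖ ^ 2 := by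
  simp [quad, ofFour, norm_smul]

theorem quad_coneBase : quad (e₁, 0, 1) = 1 := by simp [quad]

theorem basedMap_toThree : BasedMap coneCompl coneBase (nz (ℂ × ℝ)) threeBase toThree where
  cont := Continuous.continuousOn (by unfold toThree; fun_prop)
  maps := by
    rintro p hp h0
    obtain ⟨h1, h2⟩ := Prod.mk_eq_zero.1 h0
    exact hp.elim (fun h => h h1) fun h => h h2
  base := by
    change ((1 : ℂ), quad (e₁, 0, 1)) = (1, 1)
    rw [quad_coneBase]

theorem basedMap_ofThree : BasedMap (nz (ℂ × ℝ)) threeBase coneCompl coneBase ofThree where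
  cont := Continuous.continuousOn (by unfold ofThree; fun_prop)
  maps := by
    rintro p hp
    by_cases h1 : p.1 = 0
    · have h2 : p.2 ≠ 0 := fun h2 => hp (Prod.ext h1 h2)
      refine Or.inr ?_
      rw [quad_ofThree]
      rcases lt_or_gt_of_ne h2 with h | h
      · rw [max_eq_right h.le, max_eq_left (by linarith)]
        simpa using h2
      · rw [max_eq_left h.le, max_eq_right (by linarith)]
        simpa using h2
    · exact Or.inl h1
  base := by
    change ofThree (1, 1) = (e₁, 0, 1)
    simp [ofThree]

theorem basedMap_ofFour : BasedMap (nz (ℂ × ℂ)) fourBase coneCompl coneBase ofFour where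
  cont := Continuous.continuousOn (by unfold ofFour; fun_prop)
  maps := by
    rintro p hp
    by_cases h1 : p.2 = 0
    · have h2 : p.1 ≠ 0 := fun h2 => hp (Prod.ext h2 h1)
      refine Or.inr ?_
      simpa [quad_ofFour, h1] using h2
    · exact Or.inl h1
  base := by
    change ofFour (0, 1) = (e₁, 0, 1)
    simp [ofFour]

theorem toFour_eq_zero_iff {p : Triple} : toFour p = 0 ↔
    p.2.2.re - max (quad p) 0 = 0 ∧ p.2.1.im = 0 ∧ ‖p.1‖ - p.2.1.re = 0 ∧ p.2.2.im = 0 := by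
  simp [toFour, Prod.ext_iff, Complex.ext_iff, and_assoc]

theorem basedMap_toFour : BasedMap coneCompl coneBase (nz (ℂ × ℂ)) fourBase toFour where
  cont := Continuous.continuousOn (by unfold toFour; fun_prop)
  maps := by
    rintro p hp h0
    obtain ⟨h1, h2, h3, h4⟩ := toFour_eq_zero_iff.1 h0
    have hq : quad p = 0 := by
      rw [quad, ← Complex.normSq_eq_norm_sq, Complex.normSq_apply, h2,
        sub_eq_zero.1 h3]
      ring
    rw [hq, max_self, sub_zero] at h1
    exact hp.elim (fun h => h (Complex.ext h1 h4)) fun h => h hq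
  base := by
    change toFour (e₁, 0, 1) = (0, 1)
    simp [toFour, quad_coneBase]

end Maps

section Injectivity

theorem toThree_ofThree (n : ℕ) (a : HomotopyGroup (Fin (n + 1)) (nz (ℂ × ℝ)) threeBase) :
    mapHom basedMap_toThree n (mapHom basedMap_ofThree n a) = a := by
  obtain ⟨f, hf, rfl⟩ := exists_loop a
  rw [mapHom_cls, mapHom_cls]
  refine (cls_eq_of_segment hf _ fun z r ⟨hr0, hr1⟩ h0 => hf.mem z ?_).symm
  obtain ⟨h1, h2⟩ := Prod.ext_iff.1 h0
  have h1' : (1 - r) • (f z).1 + r • (f z).1 = 0 := h1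
  rw [← add_smul, sub_add_cancel, one_smul] at h1'
  have h2' : (1 - r) * (f z).2 + r * (max (f z).2 0 ^ 2 - max (-(f z).2) 0 ^ 2) = 0 := by
    rw [← quad_ofThree]
    exact h2
  suffices h : (f z).2 = 0 from Prod.ext h1' h
  by_contra hne
  rcases lt_or_gt_of_ne hne with h | h
  · rw [max_eq_right h.le, max_eq_left (by linarith)] at h2'
    have h3 : 0 < (1 - r) + r * -(f z).2 := by nlinarith
    nlinarith
  · rw [max_eq_left h.le, max_eq_right (by linarith)] at h2'
    have h3 : 0 < (1 - r) + r * (f z).2 := by nlinarith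
    nlinarith

theorem eq_zero_of_segment {w y r : ℝ} (hr0 : 0 ≤ r) (hr1 : r ≤ 1)
    (h1 : (1 - r) * (w - max (w ^ 2 - y ^ 2) 0) + r * y = 0)
    (h2 : (1 - r) * (|w| - y) + r * w = 0) : w = 0 ∧ y = 0 := by
  rcases lt_trichotomy w 0 with hw | rfl | hw
  · rw [abs_of_neg hw] at h2
    have h3 := le_max_right (w ^ 2 - y ^ 2) 0
    have hr : 0 < 1 - r := by
      by_contra hr
      have : r = 1 := by linarith
      subst this
      linarith
    have h4 : (1 - r) * -w ≤ r * y := by nlinarith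
    have h5 : (1 - r) * ((1 - r) * -w) ≤ (1 - r) * (r * y) := mul_le_mul_of_nonneg_left h4 hr.le
    have h6 : (1 - r) * (r * y) = r * (1 - 2 * r) * -w := by linear_combination -r * h2
    have h7 : 0 < 3 * r ^ 2 - 3 * r + 1 := by nlinarith [sq_nonneg (2 * r - 1)]
    nlinarith
  · rw [max_eq_right (by nlinarith [sq_nonneg y])] at h1
    rw [abs_zero] at h2
    exact ⟨rfl, by linarith⟩
  · rw [abs_of_pos hw] at h2
    have hy : (1 - r) * y = w := by linarith
    have hy0 : 0 < y := by
      by_contra hy0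
      nlinarith
    have hyw : w ≤ y := by nlinarith
    rw [max_eq_right (by nlinarith)] at h1
    have : 0 < 1 - r := by
      by_contra hr
      nlinarith
    nlinarith

theorem norm_eq_abs_re {z : ℂ} (h : z.im = 0) : ‖z‖ = |z.re| :=
  (Complex.abs_re_eq_norm.2 h).symm

theorem toFour_ofFour (n : ℕ) (a : HomotopyGroup (Fin (n + 1)) (nz (ℂ × ℂ)) fourBase) :
    mapHom basedMap_toFour n (mapHom basedMap_ofFour n a) = a := by
  obtain ⟨f, hf, rfl⟩ := exists_loop a
  rw [mapHom_cls, mapHom_cls]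
  refine cls_eq_of_segment _ hf fun z r ⟨hr0, hr1⟩ h0 => hf.mem z ?_
  obtain ⟨h1, h2⟩ := Prod.ext_iff.1 h0
  obtain ⟨h11, h12⟩ := Complex.ext_iff.1 h1
  obtain ⟨h21, h22⟩ := Complex.ext_iff.1 h2
  generalize f z = p at *
  simp only [toFour, quad_ofFour] at h11 h12 h21 h22
  simp [ofFour, norm_smul] at h11 h12 h21 h22
  have him : p.1.im = 0 := by linarith
  have him' : p.2.im = 0 := by linarith
  rw [norm_eq_abs_re him, norm_eq_abs_re him', sq_abs, sq_abs] at h11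
  rw [norm_eq_abs_re him'] at h21
  obtain ⟨hre', hre⟩ := eq_zero_of_segment hr0 hr1 h11 h21
  exact Prod.ext (Complex.ext hre him) (Complex.ext hre' him')

theorem toFour_ofThree (n : ℕ) (a : HomotopyGroup (Fin (n + 1)) (nz (ℂ × ℝ)) threeBase) :
    mapHom basedMap_toFour n (mapHom basedMap_ofThree n a) = 1 := by
  obtain ⟨f, hf, rfl⟩ := exists_loop a
  rw [mapHom_cls, mapHom_cls, ← cls_const]
  refine cls_eq_of_segment _ _ fun z r ⟨hr0, hr1⟩ h0 => ?_
  obtain ⟨h21, -⟩ := Complex.ext_iff.1 (Prod.ext_iff.1 h0).2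
  have h3 := basedMap_toFour.maps (basedMap_ofThree.maps (hf.mem z))
  generalize f z = p at *
  simp [toFour, ofThree, norm_smul, fourBase] at h21
  have hr : r = 0 := by
    have h4 := mul_nonneg (sub_nonneg.2 hr1) (abs_nonneg (max p.2 0))
    have h5 := mul_nonneg (sub_nonneg.2 hr1) (le_max_right (-p.2) 0)
    linarith
  subst hr
  rw [sub_zero, one_smul, zero_smul, add_zero] at h0
  exact h3 h0

end Injectivity

section Obstructions

/-- Removing this set makes the region `‖u‖ < ‖v‖` of the slice `w = 0` simply connected. -/
def obstrA : Set Triple := {p | p.2.2 = 0 ∧ p.2.1.im = 0 ∧ ‖p.1‖ < p.2.1.re}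

/-- The region `‖v‖ < ‖u‖` of the slice `w = 0`. -/
def obstrB : Set Triple := {p | p.2.2 = 0 ∧ 0 < quad p}

/-- Removing this set makes the region `‖v‖ < ‖u‖` of the slice `w = 0` contractible. -/
def obstrD : Set Triple := {p | p.2.2 = 0 ∧ 0 < quad p ∧ p.1 1 = 0 ∧ p.1 2 = 0 ∧ p.1 0 ≤ 0}

theorem quad_pos_iff {p : Triple} : 0 < quad p ↔ ‖p.2.1‖ < ‖p.1‖ := by
  rw [quad, sub_pos, sq_lt_sq₀ (norm_nonneg _) (norm_nonneg _)]

theorem quad_neg_iff {p : Triple} : quad p < 0 ↔ ‖p.1‖ < ‖p.2.1‖ := by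
  rw [quad, sub_neg, sq_lt_sq₀ (norm_nonneg _) (norm_nonneg _)]

theorem mem_coneCompl_of_lt {p : Triple} (h : ‖p.1‖ < ‖p.2.1‖) : p ∈ coneCompl :=
  Or.inr (quad_neg_iff.2 h).ne

theorem mem_coneCompl_of_gt {p : Triple} (h : ‖p.2.1‖ < ‖p.1‖) : p ∈ coneCompl :=
  Or.inr (quad_pos_iff.2 h).ne'

theorem slit_of_notMem_obstrA {p : Triple} (h : p ∉ obstrA) (hw : p.2.2 = 0) (hq : quad p < 0) :
    Slit p.2.1 :=
  slit_of_norm_lt (quad_neg_iff.1 hq) fun h' => h ⟨hw, h'⟩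

theorem smul_add_smul_e₁_ne_zero {u : E 3} (h : ¬ (u 1 = 0 ∧ u 2 = 0 ∧ u 0 ≤ 0)) {a b : ℝ}
    (ha : 0 ≤ a) (hb : 0 ≤ b) (hab : 0 < a + b) : a • u + b • e₁ ≠ 0 := by
  intro h0
  have h00 : a * u 0 + b = 0 := by simpa [e₁] using congrArg (fun x : E 3 => x 0) h0
  have h01 : a = 0 ∨ u 1 = 0 := by simpa [e₁] using congrArg (fun x : E 3 => x 1) h0
  have h02 : a = 0 ∨ u 2 = 0 := by simpa [e₁] using congrArg (fun x : E 3 => x 2) h0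
  rcases ha.eq_or_lt with rfl | ha
  · linarith
  · exact h ⟨h01.resolve_left ha.ne', h02.resolve_left ha.ne', by nlinarith⟩

/-- The map scaling `u` by the positive part and `v` by the negative part of `quad`. -/
def squash (p : Triple) : Triple := (max (quad p) 0 • p.1, max (-quad p) 0 • p.2.1, p.2.2)

theorem squash_segment_mem {p : Triple} (hp : p ∈ coneCompl) {r : ℝ} (hr : r ∈ Icc (0 : ℝ) 1) :
    (1 - r) • p + r • squash p ∈ coneCompl := by
  have h1 : ((1 - r) • p + r • squash p).1 = ((1 - r) + r * max (quad p) 0) • p.1 := by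
    simp [squash, add_smul, mul_smul]
  have h2 : ((1 - r) • p + r • squash p).2.1 = ((1 - r) + r * max (-quad p) 0) • p.2.1 := by
    simp [squash, add_smul, mul_smul]
  have h3 : ((1 - r) • p + r • squash p).2.2 = p.2.2 := by
    change (1 - r) • p.2.2 + r • p.2.2 = p.2.2
    module
  rcases hp with hp | hp
  · exact Or.inl (h3 ▸ hp)
  · have hr0 := hr.1
    have hr1 := sub_nonneg.2 hr.2
    have n1 := norm_nonneg p.1
    have n2 := norm_nonneg p.2.1
    rcases lt_or_gt_of_ne hp with h | h
    · refine mem_coneCompl_of_lt ?_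
      rw [h1, h2, max_eq_right h.le, max_eq_left (by linarith), norm_smul, norm_smul,
        Real.norm_of_nonneg (by linarith), Real.norm_of_nonneg (by nlinarith)]
      have h' := quad_neg_iff.1 h
      rcases hr0.eq_or_lt with rfl | hr0
      · simpa using h'
      · nlinarith [mul_pos (mul_pos hr0 (neg_pos.2 h)) (n1.trans_lt h')]
    · refine mem_coneCompl_of_gt ?_
      rw [h1, h2, max_eq_left h.le, max_eq_right (by linarith), norm_smul, norm_smul,
        Real.norm_of_nonneg (by linarith), Real.norm_of_nonneg (by nlinarith)]
      have h' := quad_pos_iff.1 h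
      rcases hr0.eq_or_lt with rfl | hr0
      · simpa using h'
      · nlinarith [mul_pos (mul_pos hr0 h) (n2.trans_lt h')]

theorem basedMap_squash : BasedMap coneCompl coneBase coneCompl coneBase squash where
  cont := Continuous.continuousOn (by unfold squash; fun_prop)
  maps p hp := by simpa using squash_segment_mem hp (r := 1) (by simp)
  base := by
    change squash (e₁, 0, 1) = (e₁, 0, 1)
    simp [squash, quad_coneBase]

theorem ofThree_toThree_of_avoids {n : ℕ} {f : UnitCube (n + 1) → Triple}
    (hf : IsLoop coneCompl coneBase f) (hA : ∀ z, f z ∉ obstrA) (hD : ∀ z, f z ∉ obstrD) :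
    mapHom basedMap_ofThree n (mapHom basedMap_toThree n hf.cls) = hf.cls := by
  rw [mapHom_cls, mapHom_cls]
  have hs : hf.cls = (hf.map basedMap_squash).cls :=
    cls_eq_of_segment _ _ fun z r hr => squash_segment_mem (hf.mem z) hr
  rw [hs]
  refine (cls_eq_of_segment _ _ fun z r ⟨hr0, hr1⟩ => ?_).symm
  have hz := hf.mem z
  specialize hA z
  specialize hD z
  beta_reduce
  generalize f z = p at *
  by_cases hw : p.2.2 = 0
  · rcases lt_or_gt_of_ne (hz.resolve_left fun h => h hw) with h | h
    · refine mem_coneCompl_of_lt ?_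
      have h1 : ((1 - r) • squash p + r • ofThree (toThree p)).1 = 0 := by
        simp [squash, ofThree, toThree, h.le]
      have h2 : ((1 - r) • squash p + r • ofThree (toThree p)).2.1 =
          ((1 - r) * -quad p) • p.2.1 - ((r * -quad p : ℝ) : ℂ) := by
        simp [squash, ofThree, toThree, h.le]
        ring
      rw [h1, h2, norm_zero, norm_pos_iff]
      exact ((slit_of_notMem_obstrA hA hw h).segment (by nlinarith) (by nlinarith)
        (by linarith)).ne_zero
    · refine mem_coneCompl_of_gt ?_
      have h1 : ((1 - r) • squash p + r • ofThree (toThree p)).2.1 = 0 := by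
        simp [squash, ofThree, toThree, h.le]
      have h2 : ((1 - r) • squash p + r • ofThree (toThree p)).1 =
          ((1 - r) * quad p) • p.1 + (r * quad p) • e₁ := by
        simp [squash, ofThree, toThree, h.le, mul_smul]
      rw [h1, h2, norm_zero, norm_pos_iff]
      exact smul_add_smul_e₁_ne_zero (fun h' => hD ⟨hw, h, h'⟩) (by nlinarith) (by nlinarith)
        (by linarith)
  · refine Or.inl ?_
    change (1 - r) • p.2.2 + r • p.2.2 ≠ 0
    rwa [← add_smul, sub_add_cancel, one_smul]

theorem exists_ofFour_eq_of_avoids {n : ℕ} {f : UnitCube (n + 1) → Triple}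
    (hf : IsLoop coneCompl coneBase f) (hB : ∀ z, f z ∉ obstrB) :
    ∃ b, mapHom basedMap_ofFour n b = hf.cls := by
  have hq : ∀ z, (f z).2.2 = 0 → quad (f z) < 0 := fun z hz =>
    lt_of_le_of_ne (not_lt.1 fun h => hB z ⟨hz, h⟩) ((hf.mem z).resolve_left fun h => h hz)
  have hfc := hf.cont
  have hg : IsLoop (nz (ℂ × ℂ)) fourBase
      fun z => (max (-quad (f z)) 0 • (f z).2.1, (f z).2.2) := by
    refine ⟨by fun_prop, fun z h0 => ?_, fun z hz => ?_⟩
    · obtain ⟨h1, h2⟩ := Prod.mk_eq_zero.1 h0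
      have h := hq z h2
      rw [max_eq_left (by linarith), smul_eq_zero_iff_right (by linarith)] at h1
      have := quad_neg_iff.1 h
      rw [h1, norm_zero] at this
      exact this.not_ge (norm_nonneg _)
    · rw [hf.bdry z hz]
      change (max (-quad (e₁, 0, 1)) 0 • (0 : ℂ), (1 : ℂ)) = (0, 1)
      rw [smul_zero]
  refine ⟨hg.cls, ?_⟩
  rw [mapHom_cls]
  refine (cls_eq_of_segment _ _ fun z r hr => ?_).symm
  by_cases hw : (f z).2.2 = 0
  · have h := hq z hw
    have hz := squash_segment_mem (hf.mem z) hr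
    convert hz using 3
    simp [ofFour, squash, hw, h.le]
  · refine Or.inl ?_
    change (1 - r) • (f z).2.2 + r • (f z).2.2 ≠ 0
    rwa [← add_smul, sub_add_cancel, one_smul]

end Obstructions

section MiddleSlice

/-- A simply connected region containing the slices to be contracted. -/
def slitRegion : Set Triple := {p | p.2.2 ≠ 0 ∨ (‖p.1‖ < ‖p.2.1‖ ∧ Slit p.2.1)}

/-- The base point `(e₁, 0, 1)`. -/
def slitBase : slitRegion := ⟨(e₁, 0, 1), Or.inl one_ne_zero⟩

/-- The first step in contracting slices in `slitRegion`. -/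
def contractOne (p : Triple) : Triple := (‖p.2.2‖ • e₁, max (-quad p) 0 • p.2.1, p.2.2)

/-- The second step in contracting slices in `slitRegion`. -/
def contractTwo (p : Triple) : Triple :=
  (p.1, p.2.1 - ((‖p.2.1‖ + 2 * (‖p.2.2‖ - p.2.2.re) : ℝ) : ℂ), p.2.2)

theorem contractOne_segment_mem {p : Triple} (hp : p ∈ slitRegion) {r : ℝ}
    (hr : r ∈ Icc (0 : ℝ) 1) : (1 - r) • p + r • contractOne p ∈ slitRegion := by
  obtain ⟨hr0, hr1⟩ := hr
  by_cases hw : p.2.2 = 0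
  · obtain ⟨h, hs⟩ := hp.resolve_left fun h => h hw
    have hq := quad_neg_iff.2 h
    have h1 : ((1 - r) • p + r • contractOne p).1 = (1 - r) • p.1 := by
      simp [contractOne, hw]
    have h2 : ((1 - r) • p + r • contractOne p).2.1 = ((1 - r) + r * -quad p) • p.2.1 := by
      simp [contractOne, add_smul, mul_smul, hq.le]
    have hpos : 0 < (1 - r) + r * -quad p := by
      rcases hr0.eq_or_lt with rfl | hr0
      · simp
      · nlinarith
    refine Or.inr ⟨?_, ?_⟩
    · rw [h1, h2, norm_smul, norm_smul, Real.norm_of_nonneg (by linarith),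
        Real.norm_of_nonneg hpos.le]
      have := norm_nonneg p.1
      rcases hr0.eq_or_lt with rfl | hr0
      · simpa using h
      · nlinarith [mul_pos (mul_pos hr0 (neg_pos.2 hq)) (this.trans_lt h)]
    · rw [h2]
      exact hs.smul hpos
  · refine Or.inl ?_
    change (1 - r) • p.2.2 + r • p.2.2 ≠ 0
    rwa [← add_smul, sub_add_cancel, one_smul]

theorem contractTwo_segment_mem {p : Triple} (hp : p ∈ slitRegion) (hu : ‖p.1‖ = ‖p.2.2‖) {r : ℝ}
    (hr : r ∈ Icc (0 : ℝ) 1) : (1 - r) • p + r • contractTwo p ∈ slitRegion := by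
  obtain ⟨hr0, hr1⟩ := hr
  by_cases hw : p.2.2 = 0
  · obtain ⟨h, hs⟩ := hp.resolve_left fun h => h hw
    rw [hw, norm_zero, norm_eq_zero] at hu
    have h1 : ((1 - r) • p + r • contractTwo p).1 = 0 := by
      simp [contractTwo, hu]
    have h2 : ((1 - r) • p + r • contractTwo p).2.1 =
        (1 : ℝ) • p.2.1 - ((r * ‖p.2.1‖ : ℝ) : ℂ) := by
      simp [contractTwo, hw]
      ring
    have hs' := hs.segment zero_le_one (mul_nonneg hr0 (norm_nonneg p.2.1))
      (by nlinarith [norm_nonneg p.2.1])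
    rw [← h2] at hs'
    refine Or.inr ⟨?_, hs'⟩
    rw [h1, norm_zero, norm_pos_iff]
    exact hs'.ne_zero
  · refine Or.inl ?_
    change (1 - r) • p.2.2 + r • p.2.2 ≠ 0
    rwa [← add_smul, sub_add_cancel, one_smul]

theorem contract_segment_mem {p : Triple} (hp : contractTwo p ∈ slitRegion)
    (hu : p.1 = ‖p.2.2‖ • e₁) {r : ℝ} (hr : r ∈ Icc (0 : ℝ) 1) :
    (1 - r) • contractTwo p + r • (e₁, (0 : ℂ), (1 : ℂ)) ∈ slitRegion := by
  obtain ⟨hr0, hr1⟩ := hr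
  rcases hr0.eq_or_lt with rfl | hr0
  · simpa using hp
  by_cases hw : ((1 - r) • contractTwo p + r • (e₁, (0 : ℂ), (1 : ℂ))).2.2 = 0
  · refine Or.inr ?_
    have hw' : (1 - r) • p.2.2 + (r : ℂ) = 0 := by simpa [contractTwo] using hw
    have hre : (1 - r) * p.2.2.re = -r := by
      have := congrArg Complex.re hw'
      simp at this
      linarith
    have hnorm : (1 - r) * ‖p.2.2‖ = r := by
      have := congrArg norm (eq_neg_of_add_eq_zero_left hw')
      rwa [norm_neg, norm_smul, Complex.norm_real, Real.norm_of_nonneg hr0.le,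
        Real.norm_of_nonneg (by linarith)] at this
    have h1 : ((1 - r) • contractTwo p + r • (e₁, (0 : ℂ), (1 : ℂ))).1 = (2 * r) • e₁ := by
      change (1 - r) • p.1 + r • e₁ = _
      rw [hu, smul_smul, hnorm, ← add_smul, two_mul]
    have h2 : ((1 - r) • contractTwo p + r • (e₁, (0 : ℂ), (1 : ℂ))).2.1.re =
        (1 - r) * (p.2.1.re - ‖p.2.1‖) - 4 * r := by
      simp [contractTwo]
      linear_combination 2 * hre - 2 * hnorm
    have h3 : (1 - r) * (p.2.1.re - ‖p.2.1‖) ≤ 0 :=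
      mul_nonpos_of_nonneg_of_nonpos (by linarith) (by linarith [Complex.re_le_norm p.2.1])
    refine ⟨?_, Or.inr (by rw [h2]; linarith)⟩
    rw [h1, norm_smul, norm_e₁, mul_one, Real.norm_of_nonneg (by linarith)]
    refine lt_of_lt_of_le ?_ (Complex.abs_re_le_norm _)
    rw [h2, abs_of_neg (by linarith)]
    linarith
  · exact Or.inl hw

theorem basedMap_contractOne : BasedMap slitRegion slitBase slitRegion slitBase contractOne where
  cont := Continuous.continuousOn (by unfold contractOne; fun_prop)
  maps p hp := by simpa using contractOne_segment_mem hp (r := 1) (by simp)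
  base := by
    change contractOne (e₁, 0, 1) = (e₁, 0, 1)
    simp [contractOne]

theorem cls_eq_const {n : ℕ} {f : UnitCube n → Triple} (hf : IsLoop slitRegion slitBase f) :
    hf.cls = (isLoop_const : IsLoop slitRegion slitBase fun _ => (slitBase : Triple)).cls := by
  have h1 := hf.map basedMap_contractOne
  have hu : ∀ z, (contractOne (f z)).1 = ‖(contractOne (f z)).2.2‖ • e₁ := fun z => rfl
  have hu' : ∀ z, ‖(contractOne (f z)).1‖ = ‖(contractOne (f z)).2.2‖ := fun z => by
    rw [hu, norm_smul, norm_e₁, mul_one, norm_norm]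
  have h2 : IsLoop slitRegion slitBase fun z => contractTwo (contractOne (f z)) := by
    refine ⟨?_, fun z => ?_, fun z hz => ?_⟩
    · have hc : Continuous contractTwo := by
        unfold contractTwo
        fun_prop
      exact hc.comp h1.cont
    · simpa using contractTwo_segment_mem (h1.mem z) (hu' z) (r := 1) (by simp)
    · have hb := h1.bdry z hz
      beta_reduce at hb
      rw [hb]
      change contractTwo (e₁, 0, 1) = (e₁, 0, 1)
      simp [contractTwo]
  calc hf.cls = h1.cls :=
        cls_eq_of_segment _ _ fun z r hr => contractOne_segment_mem (hf.mem z) hr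
    _ = h2.cls :=
        cls_eq_of_segment _ _ fun z r hr => contractTwo_segment_mem (h1.mem z) (hu' z) hr
    _ = _ := cls_eq_of_segment _ _ fun z r hr => contract_segment_mem (h2.mem z) (hu z) hr

end MiddleSlice

section Surjectivity

theorem finrank_triple : finrank ℝ Triple = 7 := by
  simp [finrank_prod]

theorem isOpen_w_ne_zero : IsOpen {p : Triple | p.2.2 ≠ 0} :=
  isOpen_ne_fun (by fun_prop) continuous_const

theorem isOpen_quad_neg : IsOpen {p : Triple | quad p < 0} :=
  isOpen_lt (by fun_prop) continuous_const

theorem isOpen_coneCompl_diff_obstrA : IsOpen (coneCompl \ obstrA) := by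
  have : coneCompl \ obstrA = coneCompl ∩ ({p : Triple | p.2.2 ≠ 0} ∪
      ({p | p.2.1.im ≠ 0} ∪ {p | p.2.1.re < ‖p.1‖})) := by
    ext p
    refine and_congr_right fun hp => ?_
    simp only [obstrA, mem_ofPred_eq, mem_union, not_and_or, not_lt]
    refine or_congr_right' fun hw => or_congr_right' fun him => ⟨fun h => h.lt_of_ne fun h' => ?_,
      le_of_lt⟩
    refine hp.resolve_left hw ?_
    rw [quad, ← Complex.normSq_eq_norm_sq, Complex.normSq_apply, not_not.1 him, h']
    ring
  rw [this]
  exact isOpen_coneCompl.inter (isOpen_w_ne_zero.union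
    ((isOpen_ne_fun (by fun_prop) continuous_const).union (isOpen_lt (by fun_prop) (by fun_prop))))

theorem isOpen_coneCompl_diff_obstrB : IsOpen (coneCompl \ obstrB) := by
  have : coneCompl \ obstrB = {p : Triple | p.2.2 ≠ 0} ∪ {p | quad p < 0} := by
    ext p
    simp only [coneCompl, obstrB, mem_sdiff, mem_ofPred_eq, mem_union]
    grind
  rw [this]
  exact isOpen_w_ne_zero.union isOpen_quad_neg

theorem isOpen_diff_obstrD : IsOpen ((coneCompl \ obstrA) \ obstrD) := by
  have : (coneCompl \ obstrA) \ obstrD = (coneCompl \ obstrA) ∩ ({p : Triple | p.2.2 ≠ 0} ∪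
      ({p | quad p < 0} ∪ ({p | p.1 1 ≠ 0} ∪ ({p | p.1 2 ≠ 0} ∪ {p | 0 < p.1 0})))) := by
    ext p
    refine and_congr_right fun hp => ?_
    have h : p.2.2 ≠ 0 ∨ quad p ≠ 0 := hp.1
    simp only [obstrD, mem_ofPred_eq, mem_union]
    grind
  rw [this]
  exact isOpen_coneCompl_diff_obstrA.inter (isOpen_w_ne_zero.union (isOpen_quad_neg.union
    ((isOpen_ne_fun (by fun_prop) continuous_const).union
    ((isOpen_ne_fun (by fun_prop) continuous_const).union
    (isOpen_lt continuous_const (by fun_prop))))))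

theorem exists_submodule_obstrA : ∃ W : Submodule ℝ Triple, finrank ℝ W ≤ 4 ∧ obstrA ⊆ W := by
  let L : E 3 × ℝ →ₗ[ℝ] Triple := (LinearMap.id.prodMap
    ((LinearMap.inl ℝ ℂ ℂ).comp Complex.ofRealCLM.toLinearMap))
  refine ⟨L.range, (LinearMap.finrank_range_le L).trans (by simp [finrank_prod]), ?_⟩
  rintro p ⟨hw, him, -⟩
  exact ⟨(p.1, p.2.1.re), Prod.ext rfl (Prod.ext (Complex.ext rfl him.symm) hw.symm)⟩

theorem exists_submodule_obstrB : ∃ W : Submodule ℝ Triple, finrank ℝ W ≤ 5 ∧ obstrB ⊆ W := by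
  let L : E 3 × ℂ →ₗ[ℝ] Triple := LinearMap.id.prodMap (LinearMap.inl ℝ ℂ ℂ)
  refine ⟨L.range, (LinearMap.finrank_range_le L).trans (by simp [finrank_prod]), ?_⟩
  rintro p ⟨hw, -⟩
  exact ⟨(p.1, p.2.1), Prod.ext rfl (Prod.ext rfl hw.symm)⟩

theorem exists_submodule_obstrD : ∃ W : Submodule ℝ Triple, finrank ℝ W ≤ 3 ∧ obstrD ⊆ W := by
  let L : ℝ × ℂ →ₗ[ℝ] Triple :=
    (LinearMap.toSpanSingleton ℝ (E 3) e₁).prodMap (LinearMap.inl ℝ ℂ ℂ)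
  refine ⟨L.range, (LinearMap.finrank_range_le L).trans (by simp [finrank_prod]), ?_⟩
  rintro p ⟨hw, -, h1, h2, -⟩
  refine ⟨(p.1 0, p.2.1), Prod.ext ?_ (Prod.ext rfl hw.symm)⟩
  ext i
  fin_cases i <;> simp [L, e₁, h1, h2]

theorem disjoint_obstr : Disjoint obstrA obstrB := by
  refine disjoint_left.2 fun p hA hB => ?_
  have h := quad_pos_iff.1 hB.2
  exact (h.trans hA.2.2).not_ge (Complex.re_le_norm _)

theorem mem_slitRegion {p : Triple} (hp : p ∈ coneCompl) (hA : p ∉ obstrA) (hB : p ∉ obstrB) :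
    p ∈ slitRegion := by
  by_cases hw : p.2.2 = 0
  · have hq : quad p < 0 := lt_of_le_of_ne (not_lt.1 fun h => hB ⟨hw, h⟩)
      (hp.resolve_left fun h => h hw)
    exact Or.inr ⟨quad_neg_iff.1 hq, slit_of_notMem_obstrA hA hw hq⟩
  · exact Or.inl hw

theorem slitRegion_subset_A : slitRegion ⊆ coneCompl \ obstrA := by
  rintro p (hp | ⟨h, hs⟩)
  · exact ⟨Or.inl hp, fun h => hp h.1⟩
  · refine ⟨mem_coneCompl_of_lt h, fun hA => ?_⟩
    exact hs.elim (fun h' => h' hA.2.1) fun h' => h'.not_gt ((norm_nonneg _).trans_lt hA.2.2)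

theorem slitRegion_subset_B : slitRegion ⊆ coneCompl \ obstrB := by
  rintro p (hp | ⟨h, hs⟩)
  · exact ⟨Or.inl hp, fun h => hp h.1⟩
  · exact ⟨mem_coneCompl_of_lt h, fun hB => h.not_gt (quad_pos_iff.1 hB.2)⟩

theorem exists_ofThree_eq {f : UnitCube 3 → Triple} (hf : IsLoop coneCompl coneBase f)
    (hA : ∀ z, f z ∉ obstrA) : ∃ a, mapHom basedMap_ofThree 2 a = hf.cls := by
  obtain ⟨W, hW, hDW⟩ := exists_submodule_obstrD
  have hbase : (coneBase : Triple) ∈ coneCompl \ obstrA :=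
    ⟨coneBase.2, fun h => one_ne_zero h.1⟩
  have hf' : IsLoop (coneCompl \ obstrA) ⟨coneBase, hbase⟩ f :=
    ⟨hf.cont, fun z => ⟨hf.mem z, hA z⟩, hf.bdry⟩
  obtain ⟨g, hg, hcls, hgD⟩ := exists_rep_avoiding isOpen_coneCompl_diff_obstrA W
    (by rw [finrank_triple]; omega) hDW isOpen_diff_obstrD (fun h => one_ne_zero h.1) hf'
  have hincl : BasedMap (coneCompl \ obstrA) ⟨coneBase, hbase⟩ coneCompl coneBase id :=
    ⟨continuousOn_id, fun _ h => h.1, rfl⟩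
  have hfg := congrArg (mapHom hincl 2) hcls
  rw [mapHom_cls, mapHom_cls] at hfg
  exact ⟨_, (ofThree_toThree_of_avoids (hg.map hincl) (fun z => (hg.mem z).2) hgD).trans hfg⟩

theorem exists_mul_eq (α : HomotopyGroup (Fin 3) coneCompl coneBase) :
    ∃ a b, mapHom basedMap_ofFour 2 b * mapHom basedMap_ofThree 2 a = α := by
  obtain ⟨f, hf, rfl⟩ := exists_loop α
  obtain ⟨WA, hWA, hAW⟩ := exists_submodule_obstrA
  obtain ⟨WB, hWB, hBW⟩ := exists_submodule_obstrB
  have hxA : (coneBase : Triple) ∉ obstrA := fun h => one_ne_zero h.1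
  have hxB : (coneBase : Triple) ∉ obstrB := fun h => one_ne_zero h.1
  obtain ⟨g, hg, hcls, hgA, hgB⟩ := exists_rep_separated isOpen_coneCompl WA WB
    (by rw [finrank_triple]; omega) hAW hBW isOpen_coneCompl_diff_obstrA
    isOpen_coneCompl_diff_obstrB hxA hxB disjoint_obstr hf
  let half : I := ⟨1 / 2, by norm_num, by norm_num⟩
  have hhalf : (half : ℝ) = 1 / 2 := rfl
  have hslice : IsLoop slitRegion slitBase fun s => g (Fin.cons half s) := by
    refine ⟨hg.cont.comp (continuous_cons_cube.comp (Continuous.prodMk_right half)),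
      fun s => mem_slitRegion (hg.mem _) (hgA _ ?_) (hgB _ ?_), fun s hs => ?_⟩
    · rw [Fin.cons_zero, hhalf]
    · rw [Fin.cons_zero, hhalf]
    · exact hg.bdry _ (cons_mem_boundary.2 (Or.inr (Or.inr hs)))
  obtain ⟨K, hKc, hKm, hK0, hK1, hKb⟩ := (cls_eq_iff _ _).1 (cls_eq_const hslice)
  have hxA' : (coneBase : Triple) ∈ coneCompl \ obstrA := ⟨coneBase.2, hxA⟩
  have hxB' : (coneBase : Triple) ∈ coneCompl \ obstrB := ⟨coneBase.2, hxB⟩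
  have hl := isLoop_lowerPart (P := coneCompl \ obstrA) (x' := ⟨coneBase, hxA'⟩) hg rfl hhalf hKc
    hK0 hK1 hKb (fun z hz => ⟨hg.mem z, hgA z hz⟩) fun r s => slitRegion_subset_A (hKm r s)
  have hu := isLoop_upperPart (P := coneCompl \ obstrB) (x' := ⟨coneBase, hxB'⟩) hg rfl hhalf hKc
    hK0 hK1 hKb (fun z hz => ⟨hg.mem z, hgB z hz⟩) fun r s => slitRegion_subset_B (hKm r s)
  have hl' : IsLoop coneCompl coneBase (lowerPart g K) :=
    ⟨hl.cont, fun z => (hl.mem z).1, hl.bdry⟩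
  have hu' : IsLoop coneCompl coneBase (upperPart g K) :=
    ⟨hu.cont, fun z => (hu.mem z).1, hu.bdry⟩
  obtain ⟨a, ha⟩ := exists_ofThree_eq hl' fun z => (hl.mem z).2
  obtain ⟨b, hb⟩ := exists_ofFour_eq_of_avoids hu' fun z => (hu.mem z).2
  refine ⟨a, b, ?_⟩
  rw [ha, hb, ← hcls]
  exact (cls_eq_mul_parts hg hhalf hKc (fun r s => (slitRegion_subset_A (hKm r s)).1) hK0 hKb hl'
    hu').symm

end Surjectivity

section Conclusion

theorem exists_equiv_prod : Nonempty (HomotopyGroup (Fin 3) (nz (ℂ × ℝ)) threeBase ×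
    HomotopyGroup (Fin 3) (nz (ℂ × ℂ)) fourBase ≃* HomotopyGroup (Fin 3) coneCompl coneBase) := by
  have hcomm : ∀ α β : HomotopyGroup (Fin 3) coneCompl coneBase, α * β = β * α :=
    (HomotopyGroup.commGroup (N := Fin 3) (X := coneCompl) (x := coneBase)).mul_comm
  let Θ := (mapHom basedMap_ofThree 2).noncommCoprod (mapHom basedMap_ofFour 2)
    fun a b => hcomm _ _
  have hΘ : ∀ a b, Θ (a, b) = mapHom basedMap_ofThree 2 a * mapHom basedMap_ofFour 2 b :=
    fun a b => rfl
  refine ⟨MulEquiv.ofBijective Θ ⟨(injective_iff_map_eq_one Θ).2 ?_, fun α => ?_⟩⟩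
  · rintro ⟨a, b⟩ h
    rw [hΘ] at h
    have hb : b = 1 := by
      have := congrArg (mapHom basedMap_toFour 2) h
      rwa [map_mul, toFour_ofThree, toFour_ofFour, one_mul, map_one] at this
    have ha := congrArg (mapHom basedMap_toThree 2) h
    rw [hb, map_one, mul_one, toThree_ofThree, map_one] at ha
    rw [ha, hb]
    rfl
  · obtain ⟨a, b, h⟩ := exists_mul_eq α
    exact ⟨(a, b), by rw [hΘ, hcomm, h]⟩

end Conclusion

end TorusComplement

theorem statement9 :
    Nonempty
      (HomotopyGroup (Fin 3) (Metric.sphere (0 : E 7) 1 \ T : Set (E 7)) basePoint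
        ≃* Multiplicative (ℤ × ℤ)) := by
  obtain ⟨e⟩ := TorusComplement.exists_equiv_coneCompl 2
  obtain ⟨e'⟩ := TorusComplement.exists_equiv_prod
  obtain ⟨e₃⟩ := TorusComplement.exists_piThree_three TorusComplement.threeBase
  obtain ⟨e₄⟩ := TorusComplement.exists_piThree_four TorusComplement.fourBase
  exact ⟨e.trans (e'.symm.trans ((e₃.prodCongr e₄).trans (MulEquiv.prodMultiplicative ℤ ℤ).symm))⟩
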